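/- arXiv:1209.0492 — 12 statements merged into one kernel-verified Lean document; each statement's English description precedes it below -/
import Mathlib

section
/- Let k be an algebraically closed field of characteristic p ≠ 2, let m ≥ 2 with gcd(m,p) = 1, and let ζ ∈ k be a primitive m-th root of unity. Let σ and τ be the k-algebra automorphisms of k(x) determined by σ : x ↦ ζ·x and τ : x ↦ 1/x, so that the subgroup of automorphisms they generate is a dihedral group of order 2m. Then the fixed field of this group acting on k(x) equals k(x^m + x^{−m}), the subfield generated over k by x^m + 1/x^m. -/
/-- Let `k` be an algebraically closed field of characteristic `p ≠ 2`,
let `m ≥ 2` with `gcd(m,p) = 1`, and let `ζ ∈ k` be a primitive `m`-th root of unity.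
Let `σ` and `τ` be the `k`-algebra automorphisms of `k(x)` determined by `σ : x ↦ ζ·x`
and `τ : x ↦ 1/x` (so that the group they generate is dihedral of order `2m`).  Then the
fixed field of this group acting on `k(x)` equals `k(x^m + x^{-m})`. -/
theorem fixedField_dihedral_eq_adjoin_pow_add_inv_pow
    (k : Type*) [Field k] [IsAlgClosed k] (p : ℕ) [CharP k p] (hp : p ≠ 2)
    (m : ℕ) (hm : 2 ≤ m) (hmp : Nat.Coprime m p)
    (ζ : k) (hζ : IsPrimitiveRoot ζ m)
    (σ τ : RatFunc k ≃ₐ[k] RatFunc k)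
    (hσ : σ RatFunc.X = RatFunc.C ζ * RatFunc.X)
    (hτ : τ RatFunc.X = (RatFunc.X : RatFunc k)⁻¹) :
    IntermediateField.fixedField (Subgroup.closure {σ, τ}) =
      IntermediateField.adjoin k
        {(RatFunc.X : RatFunc k) ^ m + ((RatFunc.X : RatFunc k) ^ m)⁻¹} := by
  classical
  set t : RatFunc k := (RatFunc.X : RatFunc k) ^ m + ((RatFunc.X : RatFunc k) ^ m)⁻¹ with ht
  set E := IntermediateField.fixedField (Subgroup.closure {σ, τ}) with hE
  have hX : (RatFunc.X : RatFunc k) ≠ 0 := RatFunc.X_ne_zero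
  have hXm : (RatFunc.X : RatFunc k) ^ m ≠ 0 := pow_ne_zero _ hX
  have hσC : ∀ c : k, σ (RatFunc.C c) = RatFunc.C c := fun c => by
    have := σ.commutes c
    rwa [RatFunc.algebraMap_eq_C] at this
  have hτC : ∀ c : k, τ (RatFunc.C c) = RatFunc.C c := fun c => by
    have := τ.commutes c
    rwa [RatFunc.algebraMap_eq_C] at this
  have hζm : (RatFunc.C ζ : RatFunc k) ^ m = 1 := by
    rw [← map_pow, hζ.pow_eq_one, map_one]
  have hσt : σ t = t := by
    rw [ht, map_add, map_inv₀, map_pow, hσ, mul_pow, hζm, one_mul]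
  have hτt : τ t = t := by
    rw [ht, map_add, map_inv₀, map_pow, hτ, inv_pow, inv_inv, add_comm]
  have hle : IntermediateField.adjoin k {t} ≤ E := by
    rw [IntermediateField.adjoin_le_iff, Set.singleton_subset_iff]
    rw [SetLike.mem_coe, hE, IntermediateField.mem_fixedField_iff]
    intro f hf
    induction hf using Subgroup.closure_induction with
    | mem x hx =>
      rcases hx with rfl | rfl
      · exact hσt
      · exact hτt
    | one => rfl
    | mul x y _ _ hx hy => rw [AlgEquiv.mul_apply, hy, hx]
    | inv x _ hx =>
      conv_lhs => rw [← hx]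
      exact x.symm_apply_apply t
  -- upper bound
  let T : IntermediateField.adjoin k {t} :=
    ⟨t, IntermediateField.mem_adjoin_simple_self k t⟩
  let q : Polynomial (IntermediateField.adjoin k {t}) :=
    Polynomial.X ^ (2 * m) + (- Polynomial.C T * Polynomial.X ^ m + 1)
  have hlow : (- Polynomial.C T * Polynomial.X ^ m + 1 :
      Polynomial (IntermediateField.adjoin k {t})).degree < ((2 * m : ℕ) : WithBot ℕ) := by
    have : (- Polynomial.C T * Polynomial.X ^ m + 1 :
      Polynomial (IntermediateField.adjoin k {t})).degree ≤ ((m : ℕ) : WithBot ℕ) := by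
      rw [← Polynomial.C_neg]
      compute_degree
      exact le_rfl
    refine this.trans_lt ?_
    exact_mod_cast (by omega : m < 2 * m)
  have hqmonic : q.Monic := Polynomial.monic_X_pow_add hlow
  have hqdeg : q.natDegree = 2 * m := by
    apply Polynomial.natDegree_eq_of_degree_eq_some
    rw [Polynomial.degree_add_eq_left_of_degree_lt, Polynomial.degree_X_pow]
    rwa [Polynomial.degree_X_pow]
  have hqX : Polynomial.aeval (RatFunc.X : RatFunc k) q = 0 := by
    have hT : algebraMap (IntermediateField.adjoin k {t}) (RatFunc k) T = t := rfl
    simp only [q, map_add, map_mul, map_neg, map_pow, Polynomial.aeval_X, Polynomial.aeval_C,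
      map_one, hT]
    rw [ht]
    field_simp
    ring
  have hint : IsIntegral (IntermediateField.adjoin k {t}) (RatFunc.X : RatFunc k) :=
    ⟨q, hqmonic, by rwa [← Polynomial.aeval_def]⟩
  have htop : ∀ K : IntermediateField k (RatFunc k),
      IntermediateField.adjoin K {(RatFunc.X : RatFunc k)} = ⊤ := fun K =>
    RatFunc.IntermediateField.adjoin_X K
  have hfr : ∀ K : IntermediateField k (RatFunc k), IsIntegral K (RatFunc.X : RatFunc k) →
      Module.finrank K (RatFunc k) = (minpoly K (RatFunc.X : RatFunc k)).natDegree := by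
    intro K hK
    rw [← IntermediateField.adjoin.finrank hK, htop K, IntermediateField.finrank_top']
  have hfd : FiniteDimensional (IntermediateField.adjoin k {t}) (RatFunc k) := by
    have := IntermediateField.adjoin.finiteDimensional hint
    rw [htop] at this
    exact Module.Finite.equiv (IntermediateField.topEquiv).toLinearEquiv
  have hup : Module.finrank (IntermediateField.adjoin k {t}) (RatFunc k) ≤ 2 * m := by
    rw [hfr _ hint, ← hqdeg]
    exact Polynomial.natDegree_le_of_dvd (minpoly.dvd _ _ hqX) hqmonic.ne_zero
  -- lower bound
  have hintE : IsIntegral E (RatFunc.X : RatFunc k) := by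
    refine ⟨q.map (IntermediateField.inclusion hle).toRingHom, hqmonic.map _, ?_⟩
    rw [Polynomial.eval₂_map]
    rw [Polynomial.aeval_def] at hqX
    exact hqX
  set P := minpoly E (RatFunc.X : RatFunc k) with hP
  have hinv : ∀ f ∈ Subgroup.closure {σ, τ}, ∀ y : RatFunc k,
      Polynomial.aeval y P = 0 → Polynomial.aeval (f y) P = 0 := by
    intro f hf y hy
    have hc : (f : RatFunc k →+* RatFunc k).comp (algebraMap E (RatFunc k)) =
        algebraMap E (RatFunc k) := by
      ext e
      exact (IntermediateField.mem_fixedField_iff _ _).1 e.2 f hf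
    have h1 := Polynomial.hom_eval₂ P (algebraMap E (RatFunc k)) (f : RatFunc k →+* RatFunc k) y
    rw [hc, ← Polynomial.aeval_def, hy, map_zero] at h1
    rw [Polynomial.aeval_def]
    exact h1.symm
  have hσmem : σ ∈ Subgroup.closure {σ, τ} := Subgroup.subset_closure (by simp)
  have hτmem : τ ∈ Subgroup.closure {σ, τ} := Subgroup.subset_closure (by simp)
  have hr1 : ∀ i : ℕ, Polynomial.aeval (RatFunc.C (ζ ^ i) * RatFunc.X : RatFunc k) P = 0 := by
    intro i
    induction i with
    | zero =>
      rw [pow_zero, map_one, one_mul]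
      exact minpoly.aeval E (RatFunc.X : RatFunc k)
    | succ n ih =>
      have := hinv σ hσmem _ ih
      rw [map_mul, hσC, hσ, ← mul_assoc, ← map_mul, ← pow_succ] at this
      exact this
  have hr2 : ∀ i : ℕ, Polynomial.aeval (RatFunc.C (ζ ^ i) * RatFunc.X⁻¹ : RatFunc k) P = 0 := by
    intro i
    have := hinv τ hτmem _ (hr1 i)
    rwa [map_mul, hτC, hτ] at this
  have hinj : ∀ i < m, ∀ j < m, RatFunc.C (ζ ^ i) = RatFunc.C (ζ ^ j) → i = j :=
    fun i hi j hj h => hζ.pow_inj hi hj (RatFunc.C_injective h)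
  have hPne : P.map (algebraMap E (RatFunc k)) ≠ 0 :=
    ((minpoly.monic hintE).map _).ne_zero
  let A : Finset (RatFunc k) := (Finset.range m).image fun i => RatFunc.C (ζ ^ i) * RatFunc.X
  let B : Finset (RatFunc k) := (Finset.range m).image fun i => RatFunc.C (ζ ^ i) * RatFunc.X⁻¹
  have hA : A.card = m := by
    rw [Finset.card_image_of_injOn, Finset.card_range]
    intro i hi j hj h
    exact hinj i (by simpa using hi) j (by simpa using hj) (mul_right_cancel₀ hX h)
  have hB : B.card = m := by
    rw [Finset.card_image_of_injOn, Finset.card_range]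
    intro i hi j hj h
    exact hinj i (by simpa using hi) j (by simpa using hj)
      (mul_right_cancel₀ (inv_ne_zero hX) h)
  have hζ0 : ζ ≠ 0 := hζ.ne_zero (by omega)
  have hCne : ∀ i : ℕ, (RatFunc.C (ζ ^ i) : RatFunc k) ≠ 0 := fun i =>
    (map_ne_zero _).2 (pow_ne_zero _ hζ0)
  have hAB : Disjoint A B := by
    rw [Finset.disjoint_left]
    intro y hyA hyB
    obtain ⟨i, -, rfl⟩ := Finset.mem_image.1 hyA
    obtain ⟨j, -, h⟩ := Finset.mem_image.1 hyB
    have h2 := congrArg RatFunc.intDegree h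
    rw [RatFunc.intDegree_mul (hCne j) (inv_ne_zero hX), RatFunc.intDegree_mul (hCne i) hX,
      RatFunc.intDegree_C, RatFunc.intDegree_C, RatFunc.intDegree_inv, RatFunc.intDegree_X] at h2
    omega
  have hsub : A ∪ B ⊆ (P.map (algebraMap E (RatFunc k))).roots.toFinset := by
    intro y hy
    rw [Multiset.mem_toFinset, Polynomial.mem_roots hPne, Polynomial.IsRoot.def,
      Polynomial.eval_map_algebraMap]
    rcases Finset.mem_union.1 hy with hy | hy
    · obtain ⟨i, -, rfl⟩ := Finset.mem_image.1 hy
      exact hr1 i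
    · obtain ⟨i, -, rfl⟩ := Finset.mem_image.1 hy
      exact hr2 i
  have hlo : 2 * m ≤ Module.finrank E (RatFunc k) := by
    rw [hfr E hintE, ← hP, ← Polynomial.natDegree_map (algebraMap E (RatFunc k))]
    calc 2 * m = (A ∪ B).card := by rw [Finset.card_union_of_disjoint hAB, hA, hB]; ring
      _ ≤ _ := Finset.card_le_card hsub
      _ ≤ _ := Multiset.toFinset_card_le _
      _ ≤ _ := Polynomial.card_roots' _
  exact (IntermediateField.eq_of_le_of_finrank_le' hle (hup.trans hlo)).symm
end

section
/- Let k be an algebraically closed field of characteristic p with p ≠ 2 and p ≠ 3, and let z = (x^{12} − 33x^{8} − 33x^{4} + 1)/(x^{2}(x^{4} − 1)^{2}) ∈ k(x). Then the field extension k(x)/k(z) has degree 12 (the order of the tetrahedral group A₄); that is, the dimension of k(x) as a vector space over the subfield k(z) is 12. -/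
open Polynomial in
theorem tetra_aux (k : Type*) [Field k] (h2 : (2 : k) ≠ 0) (N D : k[X]) (hN : N = X ^ 12 - 33 * X ^ 8 - 33 * X ^ 4 + 1)
    (hD : D = X ^ 2 * (X ^ 4 - 1) ^ 2) : IsCoprime N D ∧ N.natDegree = 12 ∧ D.natDegree = 10 := by
  refine ⟨?_, ?_, ?_⟩
  · have h1 : IsCoprime N X := ⟨1, -(X ^ 11 - 33 * X ^ 7 - 33 * X ^ 3), by rw [hN]; ring⟩
    have h3 : IsCoprime N (X ^ 4 - 1) := by
      have h64 : (C ((2 : k)⁻¹) : k[X]) * 2 = 1 := by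
        have : (2 : k[X]) = C 2 := (map_ofNat C 2).symm
        rw [this, ← C_mul, inv_mul_cancel₀ h2, C_1]
      have h64' : (C ((2 : k)⁻¹) : k[X]) ^ 6 * 64 = 1 := by
        have := congrArg (· ^ 6) h64
        simp only [mul_pow, one_pow] at this
        norm_num at this ⊢
        exact this
      refine ⟨-(C ((2 : k)⁻¹)) ^ 6, C ((2 : k)⁻¹) ^ 6 * (X ^ 8 - 32 * X ^ 4 - 65), ?_⟩
      rw [hN]
      linear_combination h64'
    rw [hD]
    exact (h1.pow_right).mul_right (h3.pow_right)
  · rw [hN]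
    have : (33 : k[X]) = C 33 := (map_ofNat C 33).symm
    rw [this]
    compute_degree!
  · have : (X ^ 4 - 1 : k[X]) = X ^ 4 - C 1 := by simp
    have hm : (X ^ 4 - C 1 : k[X]).Monic := monic_X_pow_sub_C 1 (by norm_num)
    rw [hD, this, (monic_X_pow 2).natDegree_mul (hm.pow 2), hm.natDegree_pow, natDegree_X_pow,
      natDegree_X_pow_sub_C]

/-- Let `k` be an algebraically closed field of characteristic
`p ∉ {2,3}`, and let `z = (x^12 − 33x^8 − 33x^4 + 1)/(x^2 (x^4 − 1)^2) ∈ k(x)`.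
Then `[k(x) : k(z)] = 12`, the order of the tetrahedral group `A₄`. -/
theorem finrank_adjoin_tetrahedral_rational_function
    (k : Type*) [Field k] [IsAlgClosed k] (p : ℕ) [CharP k p]
    (hp2 : p ≠ 2) (hp3 : p ≠ 3)
    (z : RatFunc k)
    (hz : z = ((RatFunc.X : RatFunc k) ^ 12 - 33 * RatFunc.X ^ 8 - 33 * RatFunc.X ^ 4 + 1) /
        (RatFunc.X ^ 2 * (RatFunc.X ^ 4 - 1) ^ 2)) :
    Module.finrank (IntermediateField.adjoin k {z}) (RatFunc k) = 12 := by
  have h2 : (2 : k) ≠ 0 := by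
    intro h
    have h' : ((2 : ℕ) : k) = 0 := by exact_mod_cast h
    rw [CharP.cast_eq_zero_iff k p] at h'
    rcases (Nat.dvd_prime Nat.prime_two).1 h' with h1 | h1
    · exact CharP.char_ne_one k p h1
    · exact hp2 h1
  obtain ⟨N, hN⟩ : ∃ N : Polynomial k, N = Polynomial.X ^ 12 - 33 * Polynomial.X ^ 8
    - 33 * Polynomial.X ^ 4 + 1 := ⟨_, rfl⟩
  obtain ⟨D, hD⟩ : ∃ D : Polynomial k, D = Polynomial.X ^ 2 * (Polynomial.X ^ 4 - 1) ^ 2 :=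
    ⟨_, rfl⟩
  obtain ⟨hc, hNd, hDd⟩ := tetra_aux k h2 N D hN hD
  have hN0 : N ≠ 0 := by rintro rfl; simp at hNd
  have hD0 : D ≠ 0 := by rintro rfl; simp at hDd
  have hz' : z = algebraMap (Polynomial k) (RatFunc k) N / algebraMap (Polynomial k) (RatFunc k) D := by
    rw [hz, hN, hD]
    have h33 : algebraMap (Polynomial k) (RatFunc k) 33 = 33 := map_ofNat _ 33
    simp [RatFunc.algebraMap_X, h33]
  have hz0 : z ≠ 0 := by
    rw [hz']
    exact div_ne_zero (RatFunc.algebraMap_ne_zero hN0) (RatFunc.algebraMap_ne_zero hD0)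
  have e : z.num * D = N * z.denom := by
    rw [RatFunc.num_mul_eq_mul_denom_iff hD0]
    exact hz'
  have d1 : N ∣ z.num := hc.dvd_of_dvd_mul_right ⟨_, e⟩
  have d2 : z.num ∣ N := z.isCoprime_num_denom.dvd_of_dvd_mul_right ⟨_, e.symm⟩
  have d3 : z.denom ∣ D := z.isCoprime_num_denom.symm.dvd_of_dvd_mul_left ⟨N, by rw [e, mul_comm]⟩
  have l1 := Polynomial.natDegree_le_of_dvd d1 (RatFunc.num_ne_zero hz0)
  have l2 := Polynomial.natDegree_le_of_dvd d2 hN0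
  have l3 := Polynomial.natDegree_le_of_dvd d3 hD0
  rw [RatFunc.finrank_eq_max_natDegree]
  omega
end

section
/- Let k be an algebraically closed field of characteristic p with p ≠ 2 and p ≠ 3, and let z = (x^{8} + 14x^{4} + 1)^{3}/(108·(x(x^{4} − 1))^{4}) ∈ k(x). Then the field extension k(x)/k(z) has degree 24 (the order of the octahedral group S₄); that is, the dimension of k(x) as a vector space over the subfield k(z) is 24. -/
open Polynomial in
theorem octahedral_coprime (k : Type*) [Field k] (h2 : (2 : k) ≠ 0) (h3 : (3 : k) ≠ 0) :
    IsCoprime ((X ^ 8 + 14 * X ^ 4 + 1 : k[X]) ^ 3) (108 * (X * (X ^ 4 - 1)) ^ 4) := by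
  have h16 : (16 : k) ≠ 0 := by
    have : (16 : k) = 2 ^ 4 := by norm_num
    rw [this]; exact pow_ne_zero _ h2
  have h108 : (108 : k) ≠ 0 := by
    have : (108 : k) = 2 ^ 2 * 3 ^ 3 := by norm_num
    rw [this]; exact mul_ne_zero (pow_ne_zero _ h2) (pow_ne_zero _ h3)
  have e16 : (C (16⁻¹ : k)) * 16 = 1 := by
    have : (16 : k[X]) = C 16 := rfl
    rw [this, ← C_mul, inv_mul_cancel₀ h16, C_1]
  have u108 : IsUnit (108 : k[X]) := by
    have : (108 : k[X]) = C 108 := rfl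
    rw [this]; exact isUnit_C.mpr h108.isUnit
  apply IsCoprime.pow_left
  rw [isCoprime_mul_unit_left_right u108]
  apply IsCoprime.pow_right
  apply IsCoprime.mul_right
  · exact ⟨1, -(X ^ 7 + 14 * X ^ 3), by ring⟩
  · exact ⟨C (16⁻¹ : k), -(C (16⁻¹ : k)) * (X ^ 4 + 15), by linear_combination e16⟩

/-- Let `k` be an algebraically closed field of characteristic
`p ∉ {2,3}`, and let `z = (x^8 + 14x^4 + 1)^3/(108 (x(x^4 − 1))^4) ∈ k(x)`.
Then `[k(x) : k(z)] = 24`, the order of the octahedral group `S₄`. -/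
theorem finrank_adjoin_octahedral_rational_function
    (k : Type*) [Field k] [IsAlgClosed k] (p : ℕ) [CharP k p]
    (hp2 : p ≠ 2) (hp3 : p ≠ 3)
    (z : RatFunc k)
    (hz : z = ((RatFunc.X : RatFunc k) ^ 8 + 14 * RatFunc.X ^ 4 + 1) ^ 3 /
        (108 * (RatFunc.X * (RatFunc.X ^ 4 - 1)) ^ 4)) :
    Module.finrank (IntermediateField.adjoin k {z}) (RatFunc k) = 24 := by
  have hne (q : ℕ) (hq : q.Prime) (hpq : p ≠ q) : (q : k) ≠ 0 := by
    intro h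
    rw [CharP.cast_eq_zero_iff k p] at h
    rcases (Nat.dvd_prime hq).mp h with h | h
    · exact CharP.ringChar_ne_one (R := k) (by rw [ringChar.eq k p, h])
    · exact hpq h
  have h2 : (2 : k) ≠ 0 := by exact_mod_cast hne 2 Nat.prime_two hp2
  have h3 : (3 : k) ≠ 0 := by exact_mod_cast hne 3 Nat.prime_three hp3
  have h108 : (108 : k) ≠ 0 := by
    have : (108 : k) = 2 ^ 2 * 3 ^ 3 := by norm_num
    rw [this]; exact mul_ne_zero (pow_ne_zero _ h2) (pow_ne_zero _ h3)
  have hc := octahedral_coprime k h2 h3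
  set P : Polynomial k := (Polynomial.X ^ 8 + 14 * Polynomial.X ^ 4 + 1) ^ 3 with hP
  set Q : Polynomial k := 108 * (Polynomial.X * (Polynomial.X ^ 4 - 1)) ^ 4 with hQ
  have dP : P.natDegree = 24 := by
    have : (Polynomial.X ^ 8 + 14 * Polynomial.X ^ 4 + 1 : Polynomial k).natDegree = 8 := by
      compute_degree!
    rw [hP, Polynomial.natDegree_pow, this]
  have dQ : Q.natDegree ≤ 20 := by
    rw [hQ]; compute_degree
  have Q0 : Q ≠ 0 := by
    rw [hQ]
    refine mul_ne_zero ?_ (pow_ne_zero _ (mul_ne_zero Polynomial.X_ne_zero ?_))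
    · have : (108 : Polynomial k) = Polynomial.C 108 := rfl
      rw [this]; exact Polynomial.C_ne_zero.mpr h108
    · exact Polynomial.X_pow_sub_C_ne_zero (n := 4) (by norm_num) (1 : k)
  have P0 : P ≠ 0 := by rintro h; rw [h] at dP; simp at dP
  have hz' : z = algebraMap _ (RatFunc k) P / algebraMap _ (RatFunc k) Q := by
    have a14 : algebraMap (Polynomial k) (RatFunc k) 14 = 14 :=
      map_ofNat (algebraMap (Polynomial k) (RatFunc k)) 14
    have a108 : algebraMap (Polynomial k) (RatFunc k) 108 = 108 :=
      map_ofNat (algebraMap (Polynomial k) (RatFunc k)) 108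
    rw [hz, hP, hQ]; simp [RatFunc.algebraMap_X, a14, a108]
  have hn : z.num ∣ P := by rw [hz']; exact RatFunc.num_div_dvd P Q0
  have hd : z.denom ∣ Q := by rw [hz']; exact RatFunc.denom_div_dvd P Q
  have hrel : z.num * Q = P * z.denom := by
    exact (RatFunc.num_mul_eq_mul_denom_iff Q0).mpr hz'
  have hPn : P ∣ z.num := hc.dvd_of_dvd_mul_right ⟨_, hrel⟩
  have z0 : z.num ≠ 0 := fun h => P0 (by rw [h] at hn; exact zero_dvd_iff.mp hn)
  have e1 : z.num.natDegree = 24 := by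
    rw [← dP]
    exact le_antisymm (Polynomial.natDegree_le_of_dvd hn P0)
      (Polynomial.natDegree_le_of_dvd hPn z0)
  have e2 := (Polynomial.natDegree_le_of_dvd hd Q0).trans dQ
  rw [RatFunc.finrank_eq_max_natDegree, e1]
  omega
end

section
/- Let k be an algebraically closed field of characteristic p with p ∉ {2, 3, 5}, and let z = (−x^{20} + 228x^{15} − 494x^{10} − 228x^{5} − 1)^{3}/((x(x^{10} + 11x^{5} − 1))^{5}) ∈ k(x). Then the field extension k(x)/k(z) has degree 60 (the order of the icosahedral group A₅); that is, the dimension of k(x) as a vector space over the subfield k(z) is 60. -/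
open Polynomial in
theorem icosa_isCoprime (k : Type*) [Field k] (h5 : (3125 : k) ≠ 0) :
    IsCoprime ((-(X : k[X]) ^ 20 + 228 * X ^ 15 - 494 * X ^ 10 - 228 * X ^ 5 - 1) ^ 3)
      ((X * (X ^ 10 + 11 * X ^ 5 - 1)) ^ 5) := by
  apply IsCoprime.pow
  apply IsCoprime.mul_right
  · exact ⟨-1, -(X : k[X]) ^ 19 + 228 * X ^ 14 - 494 * X ^ 9 - 228 * X ^ 4, by ring⟩
  · have hc : (C (3125 : k)⁻¹) * 3125 = (1 : k[X]) := by
      have : (3125 : k[X]) = C (3125 : k) := (map_ofNat C 3125).symm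
      rw [this, ← C_mul, inv_mul_cancel₀ h5, C_1]
    refine ⟨-(C (3125 : k)⁻¹) * (X ^ 5 + 11) ^ 2,
      -(C (3125 : k)⁻¹) * ((X ^ 10 - 239 * X ^ 5 - 1) * (X ^ 5 + 11) ^ 2
        + 3125 * (X ^ 10 + 11 * X ^ 5 + 1)), ?_⟩
    linear_combination hc

open Polynomial in
theorem icosa_max_natDegree (k : Type*) [Field k] (a b : k[X]) (hb : b ≠ 0)
    (h : IsCoprime a b) (z : RatFunc k)
    (hz : z = algebraMap k[X] (RatFunc k) a / algebraMap k[X] (RatFunc k) b) :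
    max z.num.natDegree z.denom.natDegree = max a.natDegree b.natDegree := by
  classical
  have hg : gcd a b = 1 := by
    rw [← normalize_gcd]
    exact normalize_eq_one.2 ((gcd_isUnit_iff a b).2 h)
  have hl : b.leadingCoeff⁻¹ ≠ 0 := inv_ne_zero (leadingCoeff_ne_zero.2 hb)
  rw [hz, RatFunc.num_div, RatFunc.denom_div _ hb, hg]
  simp only [EuclideanDomain.div_one]
  rw [natDegree_C_mul hl, natDegree_C_mul hl]

/-- Let `k` be an algebraically closed field of characteristic
`p ∉ {2,3,5}`, and let
`z = (−x^20 + 228x^15 − 494x^10 − 228x^5 − 1)^3/((x(x^10 + 11x^5 − 1))^5) ∈ k(x)`.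
Then `[k(x) : k(z)] = 60`, the order of the icosahedral group `A₅`. -/
theorem finrank_adjoin_icosahedral_rational_function
    (k : Type*) [Field k] [IsAlgClosed k] (p : ℕ) [CharP k p]
    (hp2 : p ≠ 2) (hp3 : p ≠ 3) (hp5 : p ≠ 5)
    (z : RatFunc k)
    (hz : z = (-(RatFunc.X : RatFunc k) ^ 20 + 228 * RatFunc.X ^ 15 - 494 * RatFunc.X ^ 10
          - 228 * RatFunc.X ^ 5 - 1) ^ 3 /
        ((RatFunc.X * (RatFunc.X ^ 10 + 11 * RatFunc.X ^ 5 - 1)) ^ 5)) :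
    Module.finrank (IntermediateField.adjoin k {z}) (RatFunc k) = 60 := by
  have h5 : (3125 : k) ≠ 0 := by
    intro h
    have h' : ((5 ^ 5 : ℕ) : k) = 0 := by push_cast; norm_num; exact h
    rw [CharP.cast_eq_zero_iff k p] at h'
    rcases CharP.char_is_prime_or_zero k p with hp | hp
    · exact hp5 ((Nat.prime_dvd_prime_iff_eq hp Nat.prime_five).1 (hp.dvd_of_dvd_pow h'))
    · subst hp
      norm_num at h'
  have hA : (-(Polynomial.X : Polynomial k) ^ 20 + 228 * Polynomial.X ^ 15
      - 494 * Polynomial.X ^ 10 - 228 * Polynomial.X ^ 5 - 1).natDegree = 20 := by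
    compute_degree!
  have hB : (Polynomial.X ^ 10 + 11 * Polynomial.X ^ 5 - 1 : Polynomial k).natDegree = 10 := by
    compute_degree!
  have hB0 : (Polynomial.X ^ 10 + 11 * Polynomial.X ^ 5 - 1 : Polynomial k) ≠ 0 := by
    intro h
    rw [h] at hB
    simp at hB
  have hb := pow_ne_zero 5 (mul_ne_zero (Polynomial.X_ne_zero (R := k)) hB0)
  rw [RatFunc.finrank_eq_max_natDegree,
    icosa_max_natDegree k _ _ hb (icosa_isCoprime k h5) z (by
      have e1 := map_ofNat (algebraMap (Polynomial k) (RatFunc k)) 228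
      have e2 := map_ofNat (algebraMap (Polynomial k) (RatFunc k)) 494
      have e3 := map_ofNat (algebraMap (Polynomial k) (RatFunc k)) 11
      rw [hz]
      simp only [map_pow, map_mul, map_sub, map_add, map_neg, map_one, RatFunc.algebraMap_X]
      rw [e1, e2, e3]),
    Polynomial.natDegree_pow, Polynomial.natDegree_pow,
    Polynomial.natDegree_mul Polynomial.X_ne_zero hB0, hA, hB, Polynomial.natDegree_X]
  norm_num
end

section
/- Let k be an algebraically closed field of characteristic 3 and let i ∈ k satisfy i² = −1. Let z = (x^{10} − 1)^{6}/((x(x^{10} + 2i·x^{5} + 1))^{5}) ∈ k(x). Then the field extension k(x)/k(z) has degree 60; that is, the dimension of k(x) as a vector space over the subfield k(z) is 60. -/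
open Polynomial in
theorem ratFunc_natDegree_num_denom_of_coprime {k : Type*} [Field k] (p q : k[X]) (hq : q ≠ 0)
    (h : IsCoprime p q) :
    (algebraMap k[X] (RatFunc k) p / algebraMap k[X] (RatFunc k) q).num.natDegree = p.natDegree ∧
    (algebraMap k[X] (RatFunc k) p / algebraMap k[X] (RatFunc k) q).denom.natDegree =
      q.natDegree := by
  set f := algebraMap k[X] (RatFunc k) p / algebraMap k[X] (RatFunc k) q with hf
  have e : f.num * q = p * f.denom := (RatFunc.num_mul_eq_mul_denom_iff hq).mpr hf
  have hc := RatFunc.isCoprime_num_denom f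
  have a1 : Associated f.num p := associated_of_dvd_dvd
    (hc.dvd_of_dvd_mul_right (e ▸ Dvd.intro _ rfl))
    (h.dvd_of_dvd_mul_right (e ▸ Dvd.intro _ rfl))
  have a2 : Associated f.denom q := associated_of_dvd_dvd
    (hc.symm.dvd_of_dvd_mul_left (e ▸ Dvd.intro_left _ rfl))
    (h.symm.dvd_of_dvd_mul_left (e ▸ Dvd.intro_left _ rfl))
  exact ⟨natDegree_eq_of_degree_eq (degree_eq_degree_of_associated a1),
    natDegree_eq_of_degree_eq (degree_eq_degree_of_associated a2)⟩

open Polynomial in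
theorem icosahedral_isCoprime {k : Type*} [Field k] [CharP k 3] (i : k) (hi : i ^ 2 = -1) :
    IsCoprime (((X : k[X]) ^ 10 - 1) ^ 6) ((X * (X ^ 10 + 2 * C i * X ^ 5 + 1)) ^ 5) := by
  apply IsCoprime.pow
  have h3 : (3 : k[X]) = 0 := by exact_mod_cast CharP.cast_eq_zero k[X] 3
  have hI : (C i : k[X]) ^ 2 = -1 := by rw [← C_pow, hi]; simp
  apply IsCoprime.mul_right
  · exact ⟨-1, X ^ 9, by ring⟩
  · refine ⟨6 - 2 * C i * X ^ 5, -(2 - 2 * C i * X ^ 5), ?_⟩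
    linear_combination (4 * X ^ 10) * hI - 3 * h3


/-- Let `k` be an algebraically closed field of characteristic `3` and
let `i ∈ k` satisfy `i² = −1`.  Let `z = (x^10 − 1)^6/((x(x^10 + 2i·x^5 + 1))^5) ∈ k(x)`.
Then `[k(x) : k(z)] = 60`. -/
theorem finrank_adjoin_icosahedral_rational_function_char_three
    (k : Type*) [Field k] [IsAlgClosed k] [CharP k 3]
    (i : k) (hi : i ^ 2 = -1)
    (z : RatFunc k)
    (hz : z = ((RatFunc.X : RatFunc k) ^ 10 - 1) ^ 6 /
        ((RatFunc.X * (RatFunc.X ^ 10 + 2 * RatFunc.C i * RatFunc.X ^ 5 + 1)) ^ 5)) :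
    Module.finrank (IntermediateField.adjoin k {z}) (RatFunc k) = 60 := by
  open Polynomial in
  set p : k[X] := (X ^ 10 - 1) ^ 6 with hp
  set q : k[X] := (X * (X ^ 10 + 2 * C i * X ^ 5 + 1)) ^ 5 with hqd
  have dp : p.natDegree = 60 := by
    rw [hp]; compute_degree!
  have dq : q.natDegree ≤ 55 := by
    rw [hqd]; compute_degree!
  have hc : IsCoprime p q := icosahedral_isCoprime i hi
  have hq : q ≠ 0 := by
    intro h
    rw [h, isCoprime_zero_right] at hc
    have := natDegree_eq_zero_of_isUnit hc
    omega
  have hzz : z = algebraMap k[X] (RatFunc k) p / algebraMap k[X] (RatFunc k) q := by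
    rw [hz, hp, hqd]
    have h2 : algebraMap k[X] (RatFunc k) 2 = 2 := map_ofNat _ 2
    simp [RatFunc.algebraMap_X, RatFunc.algebraMap_C, h2]
  obtain ⟨h1, h2⟩ := ratFunc_natDegree_num_denom_of_coprime p q hq hc
  rw [RatFunc.finrank_eq_max_natDegree, hzz, h1, h2, dp]
  omega
end

section
/- Let k be an algebraically closed field of characteristic p > 2 and let H be a finite subgroup of the additive group of k, of order p^t. For each a ∈ H let σ_a be the k-algebra automorphism of k(x) determined by x ↦ x + a. Then the fixed field of the group {σ_a : a ∈ H} acting on k(x) equals k(P(x)), the subfield generated over k by the polynomial P(x) = ∏_{a ∈ H} (x + a). -/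
/-- The translation automorphism `x ↦ x + a` of `k(x)`. -/
noncomputable def translationAut {k : Type*} [Field k] (a : k) : RatFunc k ≃ₐ[k] RatFunc k :=
  IsFractionRing.algEquivOfAlgEquiv (Polynomial.algEquivAevalXAddC a)

lemma translationAut_X {k : Type*} [Field k] (a : k) :
    translationAut a (RatFunc.X : RatFunc k) = RatFunc.X + RatFunc.C a := by
  rw [translationAut, ← RatFunc.algebraMap_X, IsFractionRing.algEquivOfAlgEquiv_algebraMap]
  simp [Polynomial.algEquivAevalXAddC, RatFunc.algebraMap_C]

lemma ratFunc_algEquiv_ext {k : Type*} [Field k] {g h : RatFunc k ≃ₐ[k] RatFunc k}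
    (e : g RatFunc.X = h RatFunc.X) : g = h := by
  have key : ∀ q : Polynomial k, g (algebraMap _ _ q) = h (algebraMap _ _ q) := by
    intro q
    rw [← RatFunc.aeval_X_left_eq_algebraMap, ← Polynomial.aeval_algHom_apply,
      ← Polynomial.aeval_algHom_apply, e]
  ext f
  rw [← RatFunc.num_div_denom f, map_div₀, map_div₀, key, key]

/-- Let `k` be an algebraically closed field of characteristic `p > 2`
and let `H` be a finite subgroup of the additive group of `k`, of order `p^t`.  For each
`a ∈ H` let `σ_a` be the `k`-algebra automorphism of `k(x)` determined by `x ↦ x + a`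
(an automorphism of `k(x)` over `k` is determined by its value on `x`, so the group
`{σ_a : a ∈ H}` is described by the membership condition below).  Then the fixed field
of the group `{σ_a : a ∈ H}` acting on `k(x)` equals `k(P(x))` where
`P(x) = ∏_{a ∈ H} (x + a)`. -/
theorem fixedField_translations_eq_adjoin_prod
    (k : Type*) [Field k] [IsAlgClosed k] (p : ℕ) [CharP k p] (hp : 2 < p)
    (H : AddSubgroup k) [Fintype H] (t : ℕ) (hH : Fintype.card H = p ^ t)
    (G : Subgroup (RatFunc k ≃ₐ[k] RatFunc k))
    (hG : ∀ g : RatFunc k ≃ₐ[k] RatFunc k,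
      g ∈ G ↔ ∃ a ∈ H, g RatFunc.X = RatFunc.X + RatFunc.C a) :
    IntermediateField.fixedField G =
      IntermediateField.adjoin k
        {∏ a : H, ((RatFunc.X : RatFunc k) + RatFunc.C (a : k))} := by
  classical
  set P : RatFunc k := ∏ a : H, ((RatFunc.X : RatFunc k) + RatFunc.C (a : k)) with hP
  have hPpoly : P = algebraMap (Polynomial k) (RatFunc k)
      (∏ a : H, (Polynomial.X + Polynomial.C (a : k))) := by
    simp [hP, map_prod, RatFunc.algebraMap_X, RatFunc.algebraMap_C]
  have hdeg : Module.finrank (IntermediateField.adjoin k {P}) (RatFunc k) = Fintype.card H := by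
    rw [RatFunc.finrank_eq_max_natDegree, hPpoly, RatFunc.num_algebraMap,
      RatFunc.denom_algebraMap, Polynomial.natDegree_prod_of_monic]
    · simp
    · intro a _
      exact Polynomial.monic_X_add_C _
  -- the group `G` is in bijection with `H`
  let ρ : H → G := fun a => ⟨translationAut (a : k), (hG _).2 ⟨a, a.2, translationAut_X _⟩⟩
  have hρ : Function.Bijective ρ := by
    constructor
    · intro a b hab
      have h1 : translationAut (a : k) = translationAut (b : k) := congrArg Subtype.val hab
      have h2 := translationAut_X (a : k)
      rw [h1, translationAut_X] at h2
      exact Subtype.ext (RatFunc.C_injective (add_left_cancel h2)).symm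
    · rintro ⟨g, hg⟩
      obtain ⟨a, ha, hga⟩ := (hG g).1 hg
      exact ⟨⟨a, ha⟩, Subtype.ext (ratFunc_algEquiv_ext ((translationAut_X a).trans hga.symm))⟩
  have : Fintype G := Fintype.ofBijective ρ hρ
  have hcard : Fintype.card G = Fintype.card H := (Fintype.card_of_bijective hρ).symm
  have hfix : Module.finrank (IntermediateField.fixedField G) (RatFunc k) = Fintype.card G :=
    FixedPoints.finrank_eq_card G (RatFunc k)
  have hle : IntermediateField.adjoin k {P} ≤ IntermediateField.fixedField G := by
    rw [IntermediateField.adjoin_simple_le_iff, IntermediateField.mem_fixedField_iff]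
    intro g hg
    obtain ⟨a, ha, hga⟩ := (hG g).1 hg
    have hgC : ∀ c : k, g (RatFunc.C c) = RatFunc.C c := fun c => g.commutes c
    rw [hP, map_prod]
    simp only [map_add, hga, hgC]
    refine Fintype.prod_equiv (Equiv.addLeft (⟨a, ha⟩ : H)) _ _ fun b => ?_
    simp [add_assoc]
  have : FiniteDimensional (IntermediateField.adjoin k {P}) (RatFunc k) :=
    Module.finite_of_finrank_pos (by rw [hdeg]; exact Fintype.card_pos)
  exact (IntermediateField.eq_of_le_of_finrank_eq' hle (by rw [hdeg, hfix, hcard])).symm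
end

section
/- Let k be an algebraically closed field of characteristic p > 2, let H be a finite subgroup of the additive group of k of order p^t, let m ≥ 2 divide p^t − 1, and let ζ ∈ k be a primitive m-th root of unity such that ζ·H = H. Let G be the group of k-algebra automorphisms of k(x) generated by the translations x ↦ x + a for a ∈ H together with x ↦ ζ·x (a group of order m·p^t). Then the fixed field of G acting on k(x) equals k(w), the subfield generated over k by w = (∏_{a ∈ H} (x + a))^m. -/
open scoped Pointwise

/-- The substitution `x ↦ u x + b` extends to a `k`-automorphism of `k(x)`. -/
lemma exists_affine_aut (k : Type*) [Field k] (u b : k) (hu : u ≠ 0) :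
    ∃ g : RatFunc k ≃ₐ[k] RatFunc k,
      g RatFunc.X = RatFunc.C u * RatFunc.X + RatFunc.C b := by
  letI : Invertible u := invertibleOfNonzero hu
  refine ⟨IsFractionRing.fieldEquivOfAlgEquiv k (RatFunc k) (RatFunc k)
    (Polynomial.algEquivCMulXAddC u b), ?_⟩
  rw [← RatFunc.algebraMap_X, IsFractionRing.fieldEquivOfAlgEquiv_algebraMap]
  simp [Polynomial.algEquivCMulXAddC_apply]

lemma aut_C {k : Type*} [Field k] (g : RatFunc k ≃ₐ[k] RatFunc k) (c : k) :
    g (RatFunc.C c) = RatFunc.C c := by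
  rw [← RatFunc.algebraMap_eq_C]; exact g.commutes c

/-- `C u * X + C a` determines `u` and `a`. -/
lemma affine_inj {k : Type*} [Field k] {u v a b : k}
    (h : (RatFunc.C u * RatFunc.X + RatFunc.C a : RatFunc k)
      = RatFunc.C v * RatFunc.X + RatFunc.C b) : u = v ∧ a = b := by
  have h2 : (Polynomial.C u * Polynomial.X + Polynomial.C a)
      = (Polynomial.C v * Polynomial.X + Polynomial.C b) := by
    apply RatFunc.algebraMap_injective k
    simpa using h
  constructor
  · simpa using congrArg (fun q => Polynomial.coeff q 1) h2
  · simpa using congrArg (fun q => Polynomial.coeff q 0) h2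

/-- Degree of `k(x)` over `k(w)`. -/
lemma finrank_w {k : Type*} [Field k] (H : AddSubgroup k) [Fintype H] (m : ℕ) :
    Module.finrank (IntermediateField.adjoin k
        {(∏ a : H, ((RatFunc.X : RatFunc k) + RatFunc.C (a : k))) ^ m}) (RatFunc k)
      = m * Fintype.card H := by
  have h : (∏ a : H, ((RatFunc.X : RatFunc k) + RatFunc.C (a : k))) ^ m
      = algebraMap (Polynomial k) (RatFunc k)
        ((∏ a : H, (Polynomial.X + Polynomial.C (a : k))) ^ m) := by
    simp
  rw [h, RatFunc.finrank_eq_max_natDegree, RatFunc.num_algebraMap, RatFunc.denom_algebraMap,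
    Polynomial.natDegree_pow,
    Polynomial.natDegree_prod_of_monic _ _ (fun a _ => Polynomial.monic_X_add_C _)]
  simp

/-- Let `k` be an algebraically closed field of characteristic `p > 2`,
let `H` be a finite subgroup of the additive group of `k` of order `p^t`, let `m ≥ 2`
divide `p^t − 1`, and let `ζ ∈ k` be a primitive `m`-th root of unity with `ζ·H = H`.
Let `G` be the group of `k`-algebra automorphisms of `k(x)` generated by the
translations `x ↦ x + a` for `a ∈ H` together with `x ↦ ζ·x`.  Then the fixed field of
`G` acting on `k(x)` equals `k(w)` where `w = (∏_{a ∈ H} (x + a))^m`. -/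
theorem fixedField_Km_eq_adjoin_prod_pow
    (k : Type*) [Field k] [IsAlgClosed k] (p : ℕ) [CharP k p] (hp : 2 < p)
    (H : AddSubgroup k) [Fintype H] (t : ℕ) (hH : Fintype.card H = p ^ t)
    (m : ℕ) (hm : 2 ≤ m) (hmd : m ∣ p ^ t - 1)
    (ζ : k) (hζ : IsPrimitiveRoot ζ m) (hζH : ζ • (H : Set k) = (H : Set k))
    (G : Subgroup (RatFunc k ≃ₐ[k] RatFunc k))
    (hGen : G = Subgroup.closure
      ({g : RatFunc k ≃ₐ[k] RatFunc k | ∃ a ∈ H, g RatFunc.X = RatFunc.X + RatFunc.C a} ∪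
       {g : RatFunc k ≃ₐ[k] RatFunc k | g RatFunc.X = RatFunc.C ζ * RatFunc.X})) :
    IntermediateField.fixedField G =
      IntermediateField.adjoin k
        {(∏ a : H, ((RatFunc.X : RatFunc k) + RatFunc.C (a : k))) ^ m} := by
  have hm0 : 0 < m := by omega
  have hζ0 : ζ ≠ 0 := hζ.ne_zero (by omega)
  have hHpos : 0 < Fintype.card H := Fintype.card_pos
  have hζmul : ∀ a : H, ζ * (a : k) ∈ H := by
    intro a
    have : ζ • (a : k) ∈ ζ • (H : Set k) := Set.smul_mem_smul_set a.2
    rw [hζH] at this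
    simpa using this
  set P : RatFunc k := ∏ a : H, ((RatFunc.X : RatFunc k) + RatFunc.C (a : k)) with hP
  have hfin := finrank_w H m
  rw [← hP] at hfin
  -- `w` is fixed
  have hle : IntermediateField.adjoin k {P ^ m} ≤ IntermediateField.fixedField G := by
    rw [IntermediateField.adjoin_simple_le_iff, IntermediateField.mem_fixedField_iff]
    have key : G ≤ MulAction.stabilizer (RatFunc k ≃ₐ[k] RatFunc k) (P ^ m) := by
      rw [hGen, Subgroup.closure_le]
      rintro g (⟨a, ha, hg⟩ | hg)
      · change g (P ^ m) = P ^ m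
        have : g P = P := by
          simp only [hP, map_prod, map_add, hg, aut_C]
          refine Fintype.prod_equiv (Equiv.addLeft (⟨a, ha⟩ : H)) _ _ ?_
          intro b
          simp [add_assoc]
        rw [map_pow, this]
      · change g (P ^ m) = P ^ m
        have hg' : g RatFunc.X = RatFunc.C ζ * RatFunc.X := hg
        have hbij : Function.Bijective (fun b : H => (⟨ζ * b, hζmul b⟩ : H)) := by
          rw [← Finite.injective_iff_bijective]
          intro b c hbc
          have := congrArg Subtype.val hbc
          exact Subtype.ext (mul_left_cancel₀ hζ0 this)
        have : g P = RatFunc.C ζ ^ Fintype.card H * P := by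
          have h1 : g P = ∏ b : H, (RatFunc.C ζ * RatFunc.X + RatFunc.C (b : k)) := by
            simp only [hP, map_prod, map_add, hg', aut_C]
          rw [h1, ← hbij.prod_comp]
          simp only [map_mul, ← mul_add, Finset.prod_mul_distrib]
          simp [hP]
        rw [map_pow, this, mul_pow, ← pow_mul, mul_comm _ m, pow_mul, ← map_pow, hζ.pow_eq_one]
        simp
    intro f hf
    exact key hf
  haveI hFfin : FiniteDimensional (IntermediateField.adjoin k {P ^ m}) (RatFunc k) :=
    Module.finite_of_finrank_pos (by rw [hfin]; positivity)
  symm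
  refine IntermediateField.eq_of_le_of_finrank_le' hle ?_
  rw [hfin]
  haveI : FiniteDimensional (IntermediateField.fixedField G) (RatFunc k) := by
    letI := (IntermediateField.inclusion hle).toRingHom.toAlgebra
    haveI : IsScalarTower (IntermediateField.adjoin k {P ^ m})
      (IntermediateField.fixedField G) (RatFunc k) := IsScalarTower.of_algebraMap_eq' rfl
    exact Module.Finite.of_restrictScalars_finite (IntermediateField.adjoin k {P ^ m}) _ _
  -- automorphisms
  have hex : ∀ q : Fin m × H, ∃ g ∈ G,
      g RatFunc.X = RatFunc.C (ζ ^ (q.1 : ℕ)) * RatFunc.X + RatFunc.C (q.2 : k) := by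
    rintro ⟨i, a⟩
    obtain ⟨τ, hτ⟩ := exists_affine_aut k 1 (a : k) one_ne_zero
    obtain ⟨σ, hσ⟩ := exists_affine_aut k ζ 0 hζ0
    have hσ' : σ RatFunc.X = RatFunc.C ζ * RatFunc.X := by simpa using hσ
    have hτ' : τ RatFunc.X = RatFunc.X + RatFunc.C (a : k) := by simpa using hτ
    have hσG : σ ∈ G := by rw [hGen]; exact Subgroup.subset_closure (Or.inr hσ')
    have hτG : τ ∈ G := by rw [hGen]; exact Subgroup.subset_closure (Or.inl ⟨a, a.2, hτ'⟩)
    refine ⟨σ ^ (i : ℕ) * τ, G.mul_mem (G.pow_mem hσG _) hτG, ?_⟩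
    have hpow : ∀ n : ℕ, (σ ^ n) RatFunc.X = RatFunc.C (ζ ^ n) * RatFunc.X := by
      intro n
      induction n with
      | zero => simp
      | succ n ih =>
        rw [pow_succ, AlgEquiv.mul_apply, hσ', map_mul, ih, aut_C, pow_succ, map_mul]
        ring
    rw [AlgEquiv.mul_apply, hτ', map_add, hpow, aut_C]
  choose g hgG hg using hex
  have hG : G ≤ IntermediateField.fixingSubgroup (IntermediateField.fixedField G) :=
    (IntermediateField.le_iff_le _ _).mp le_rfl
  let φ : Fin m × H → (RatFunc k ≃ₐ[IntermediateField.fixedField G] RatFunc k) :=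
    fun q => IntermediateField.fixingSubgroupEquiv _ ⟨g q, hG (hgG q)⟩
  have hφ : Function.Injective φ := by
    intro q r hqr
    have h1 : g q = g r := by
      have := (IntermediateField.fixingSubgroupEquiv _).injective hqr
      exact congrArg Subtype.val this
    have h2 := hg q
    rw [h1, hg r] at h2
    obtain ⟨h3, h4⟩ := affine_inj h2
    refine Prod.ext (Fin.ext ?_) (Subtype.ext h4.symm)
    exact (hζ.pow_inj r.1.2 q.1.2 h3).symm
  calc m * Fintype.card H = Fintype.card (Fin m × H) := by simp
    _ ≤ Fintype.card (RatFunc k ≃ₐ[IntermediateField.fixedField G] RatFunc k) :=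
      Fintype.card_le_of_injective φ hφ
    _ ≤ _ := AlgEquiv.card_le
end

section
/- Let p be an odd prime, q = p^r, and let k be an algebraically closed field of characteristic p containing the finite field F_q with q elements. Let G be the group of k-algebra automorphisms of k(x) induced by all Möbius substitutions x ↦ (ax+b)/(cx+d) with a,b,c,d ∈ F_q and ad − bc = 1 (so G ≅ PSL₂(q)). Then the fixed field of G acting on k(x) equals k(z), the subfield generated over k by z = ((x^q − x)^{q−1} + 1)^{(q+1)/2} / (x^q − x)^{q(q−1)/2}. -/
namespace PSLAux
open Polynomial in
lemma lin_eq {k : Type*} [Field k] {a b : k}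
    (h : RatFunc.C a * RatFunc.X + RatFunc.C b = (0 : RatFunc k)) : a = 0 ∧ b = 0 := by
  have h1 : algebraMap k[X] (RatFunc k) (C a * X + C b) = algebraMap k[X] (RatFunc k) 0 := by
    simpa using h
  have h2 := RatFunc.algebraMap_injective k h1
  constructor
  · simpa using congrArg (fun f => f.coeff 1) h2
  · simpa using congrArg (fun f => f.coeff 0) h2

open Polynomial in
lemma quad_eq {k : Type*} [Field k] {a b c d a' b' c' d' : k}
    (h : (RatFunc.C a * RatFunc.X + RatFunc.C b) * (RatFunc.C c' * RatFunc.X + RatFunc.C d') =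
      (RatFunc.C a' * RatFunc.X + RatFunc.C b') * (RatFunc.C c * RatFunc.X + RatFunc.C d : RatFunc k)) :
    a * c' = a' * c ∧ a * d' + b * c' = a' * d + b' * c ∧ b * d' = b' * d := by
  have h1 : algebraMap k[X] (RatFunc k) (C (a*c') * X^2 + C (a * d' + b * c') * X + C (b * d')) =
     algebraMap k[X] (RatFunc k) (C (a'*c) * X^2 + C (a' * d + b' * c) * X + C (b' * d)) := by
    simp only [map_add, map_mul, map_pow, RatFunc.algebraMap_C, RatFunc.algebraMap_X]
    linear_combination h
  have h2 := RatFunc.algebraMap_injective k h1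
  generalize a * c' = α, a' * c = α', a * d' + b * c' = β, a' * d + b' * c = β', b * d' = γ, b' * d = γ' at h2 ⊢
  refine ⟨?_, ?_, ?_⟩
  · simpa [coeff_X, coeff_C] using congrArg (fun f => f.coeff 2) h2
  · simpa [coeff_X, coeff_C] using congrArg (fun f => f.coeff 1) h2
  · simpa using congrArg (fun f => f.coeff 0) h2

lemma den_ne {k : Type*} [Field k] {a b c d : k} (h : a * d - b * c = 1) :
    (RatFunc.C c * RatFunc.X + RatFunc.C d : RatFunc k) ≠ 0 := by
  intro h0
  obtain ⟨h1, h2⟩ := lin_eq h0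
  simp [h1, h2] at h

lemma sign {k : Type*} [Field k] {a b c d a' b' c' d' : k} (h : a * d - b * c = 1)
    (h' : a' * d' - b' * c' = 1)
    (e : (RatFunc.C a * RatFunc.X + RatFunc.C b) / (RatFunc.C c * RatFunc.X + RatFunc.C d) =
      (RatFunc.C a' * RatFunc.X + RatFunc.C b') / (RatFunc.C c' * RatFunc.X + RatFunc.C d' : RatFunc k)) :
    (a' = a ∧ b' = b ∧ c' = c ∧ d' = d) ∨ (a' = -a ∧ b' = -b ∧ c' = -c ∧ d' = -d) := by
  rw [div_eq_div_iff (den_ne h) (den_ne h')] at e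
  obtain ⟨e1, e2, e3⟩ := quad_eq e
  set s := a * d' - b' * c with hs
  have ha : a' = s * a := by linear_combination (-a') * h - a * e2 + b * e1
  have hb : b' = s * b := by linear_combination (-b') * h - a * e3
  have hc : c' = s * c := by linear_combination (-c') * h + d * e1 - c * e2
  have hd : d' = s * d := by linear_combination (-d') * h - c * e3
  have : s * s = 1 := by
    rw [ha, hb, hc, hd] at h'
    linear_combination h' - s * s * h
  rcases mul_self_eq_one_iff.mp this with h1 | h1 <;> rw [h1] at ha hb hc hd
  · left; simp_all
  · right; simp [ha, hb, hc, hd]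

lemma exists_aut {k : Type*} [Field k] {a b c d : k} (h : a * d - b * c = 1) :
    ∃ g : RatFunc k ≃ₐ[k] RatFunc k, g RatFunc.X = (RatFunc.C a * RatFunc.X + RatFunc.C b) /
          (RatFunc.C c * RatFunc.X + RatFunc.C d) := by
  set m : RatFunc k := (RatFunc.C a * RatFunc.X + RatFunc.C b) /
          (RatFunc.C c * RatFunc.X + RatFunc.C d) with hm
  have hden := den_ne h
  have hC : (RatFunc.C a * RatFunc.C d - RatFunc.C b * RatFunc.C c : RatFunc k) = 1 := by
    rw [← map_mul, ← map_mul, ← map_sub, h, map_one]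
  have hm1 : m * (RatFunc.C c * RatFunc.X + RatFunc.C d) = RatFunc.C a * RatFunc.X + RatFunc.C b :=
    div_mul_cancel₀ _ hden
  have h1 : (RatFunc.C a - RatFunc.C c * m) * (RatFunc.C c * RatFunc.X + RatFunc.C d) = 1 := by
    linear_combination hC - RatFunc.C c * hm1
  have h2 : (RatFunc.C a - RatFunc.C c * m) ≠ 0 := left_ne_zero_of_mul_eq_one h1
  have hX : (RatFunc.X : RatFunc k) =
      (RatFunc.C d * m - RatFunc.C b) / (RatFunc.C a - RatFunc.C c * m) := by
    rw [eq_div_iff h2]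
    linear_combination -hm1
  have htop : IntermediateField.adjoin k {m} = ⊤ := by
    rw [eq_top_iff, ← RatFunc.adjoin_X, IntermediateField.adjoin_simple_le_iff]
    have hmm := IntermediateField.mem_adjoin_simple_self k m
    have hCm : ∀ e : k, RatFunc.C e ∈ IntermediateField.adjoin k {m} := fun e => by
      rw [← RatFunc.algebraMap_eq_C]
      exact IntermediateField.algebraMap_mem _ e
    rw [hX]
    exact div_mem (sub_mem (mul_mem (hCm _) hmm) (hCm _)) (sub_mem (hCm _) (mul_mem (hCm _) hmm))
  have htr : Transcendental k m := by
    apply RatFunc.transcendental_of_ne_C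
    rintro ⟨e, he⟩
    rw [he] at hm1
    have : RatFunc.C (a - e * c) * RatFunc.X + RatFunc.C (b - e * d) = (0 : RatFunc k) := by
      simp only [map_sub, map_mul]
      linear_combination -hm1
    obtain ⟨h3, h4⟩ := lin_eq this
    have : (1 : k) = 0 := by linear_combination -h + d * h3 - c * h4
    exact one_ne_zero this
  refine ⟨(RatFunc.algEquivOfTranscendental m htr).trans
    ((IntermediateField.equivOfEq htop).trans IntermediateField.topEquiv), ?_⟩
  simp

lemma inv_core {L : Type*} [Field L] (n : ℕ) (u v c : L) (hu : u ≠ 0) (hv : v ≠ 0)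
    (h1 : v ^ (2 * n + 1) = v + c * u)
    (h2 : (v ^ (2 * n + 1)) ^ (2 * n + 1) = v ^ (2 * n + 1) + c * u ^ (2 * n + 1)) :
    ((u / v ^ (2 * n + 2)) ^ (2 * n) + 1) ^ (n + 1) / (u / v ^ (2 * n + 2)) ^ ((2 * n + 1) * n) =
    (u ^ (2 * n) + 1) ^ (n + 1) / u ^ ((2 * n + 1) * n) := by
  have key : (u / v ^ (2 * n + 2)) ^ (2 * n) + 1 =
      (u ^ (2 * n) + 1) / v ^ ((2 * n + 1) * (2 * n)) := by
    have e1 : u ^ (2 * n) + v ^ ((2 * n + 2) * (2 * n)) = (u ^ (2 * n) + 1) * v ^ (2 * n) := by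
      apply mul_right_cancel₀ (mul_ne_zero hu hv)
      have e2 : (u ^ (2 * n) + v ^ ((2 * n + 2) * (2 * n))) * (u * v) =
        u ^ (2 * n + 1) * v + u * (v ^ (2 * n + 1)) ^ (2 * n + 1) := by ring
      have e3 : (u ^ (2 * n) + 1) * v ^ (2 * n) * (u * v) =
        (u ^ (2 * n + 1) + u) * v ^ (2 * n + 1) := by ring
      rw [e2, e3, h2, h1]; ring
    rw [div_pow, ← pow_mul, eq_div_iff (pow_ne_zero _ hv), add_mul, div_mul_eq_mul_div,
      one_mul, div_add' _ _ _ (pow_ne_zero _ hv), div_eq_iff (pow_ne_zero _ hv)]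
    have e4 : v ^ ((2 * n + 2) * (2 * n)) = v ^ ((2 * n + 1) * (2 * n)) * v ^ (2 * n) := by ring
    rw [e4] at e1 ⊢
    linear_combination v ^ ((2 * n + 1) * (2 * n)) * e1
  rw [key, div_pow, div_pow, ← pow_mul, ← pow_mul]
  have : (2 * n + 1) * (2 * n) * (n + 1) = (2 * n + 2) * ((2 * n + 1) * n) := by ring
  rw [this, div_div_div_cancel_right₀ (pow_ne_zero _ hv)]

lemma inv_aut {k : Type*} [Field k] (p : ℕ) [CharP k p] (hp : p.Prime) (r n : ℕ)
    (hq : 2 * n + 1 = p ^ r) (a b c d : k) (ha : a ^ (2 * n + 1) = a) (hb : b ^ (2 * n + 1) = b)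
    (hc : c ^ (2 * n + 1) = c) (hd : d ^ (2 * n + 1) = d) (h : a * d - b * c = 1)
    (hu : (RatFunc.X : RatFunc k) ^ (2 * n + 1) - RatFunc.X ≠ 0)
    (g : RatFunc k ≃ₐ[k] RatFunc k)
    (hg : g RatFunc.X = (RatFunc.C a * RatFunc.X + RatFunc.C b) /
          (RatFunc.C c * RatFunc.X + RatFunc.C d)) :
    g (((((RatFunc.X : RatFunc k) ^ (2 * n + 1) - RatFunc.X) ^ (2 * n) + 1) ^ (n + 1)) /
          (((RatFunc.X : RatFunc k) ^ (2 * n + 1) - RatFunc.X) ^ ((2 * n + 1) * n))) =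
      ((((RatFunc.X : RatFunc k) ^ (2 * n + 1) - RatFunc.X) ^ (2 * n) + 1) ^ (n + 1)) /
          (((RatFunc.X : RatFunc k) ^ (2 * n + 1) - RatFunc.X) ^ ((2 * n + 1) * n)) := by
  haveI : Fact p.Prime := ⟨hp⟩
  haveI : CharP (RatFunc k) p := charP_of_injective_algebraMap (algebraMap k (RatFunc k)).injective p
  have hv := den_ne h
  have hC : (RatFunc.C a * RatFunc.C d - RatFunc.C b * RatFunc.C c : RatFunc k) = 1 := by
    rw [← map_mul, ← map_mul, ← map_sub, h, map_one]
  have frob : ∀ (x y : RatFunc k), (x + y) ^ (2 * n + 1) = x ^ (2 * n + 1) + y ^ (2 * n + 1) := by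
    intro x y
    rw [hq]; exact add_pow_char_pow ..
  have frobs : ∀ (x y : RatFunc k), (x - y) ^ (2 * n + 1) = x ^ (2 * n + 1) - y ^ (2 * n + 1) := by
    intro x y
    rw [hq]; exact sub_pow_char_pow ..
  have lin : ∀ (a b : k) (x : RatFunc k), a ^ (2 * n + 1) = a → b ^ (2 * n + 1) = b →
      (RatFunc.C a * x + RatFunc.C b) ^ (2 * n + 1) =
        RatFunc.C a * x ^ (2 * n + 1) + RatFunc.C b := by
    intro a b x ha hb
    rw [frob, mul_pow, ← map_pow, ← map_pow, ha, hb]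
  have h1 := lin c d RatFunc.X hc hd
  have hgu : g ((RatFunc.X : RatFunc k) ^ (2 * n + 1) - RatFunc.X) =
      (RatFunc.X ^ (2 * n + 1) - RatFunc.X) /
        (RatFunc.C c * RatFunc.X + RatFunc.C d) ^ (2 * n + 2) := by
    have hv' := pow_ne_zero (2 * n + 1) hv
    rw [map_sub, map_pow, hg, div_pow, div_sub_div _ _ hv' hv, ← pow_succ]
    congr 1
    rw [h1, lin a b _ ha hb]
    linear_combination (RatFunc.X ^ (2 * n + 1) - RatFunc.X) * hC
  rw [map_div₀, map_pow, map_pow, map_add, map_pow, map_one, hgu]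
  apply inv_core n _ _ (RatFunc.C c) hu hv
  · rw [h1]; ring
  · rw [h1, lin c d _ hc hd, frobs]; ring

section count
variable {k : Type*} [Field k] (F : Subfield k)

/-- Parametrised matrices of determinant one. -/
def mat (t : Fˣ × Option F × F) : k × k × k × k :=
  match t with
  | (e, none, f) => (((e : F) : k), (f : k), 0, ((e : F) : k)⁻¹)
  | (e, some a, d) => ((a : k), ((a : k) * d - 1) / ((e : F) : k), ((e : F) : k), (d : k))

lemma une (e : Fˣ) : ((e : F) : k) ≠ 0 := by
  have := e.ne_zero
  simpa using this

lemma mat_spec (t : Fˣ × Option F × F) : (mat F t).1 ∈ F ∧ (mat F t).2.1 ∈ F ∧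
    (mat F t).2.2.1 ∈ F ∧ (mat F t).2.2.2 ∈ F ∧
    (mat F t).1 * (mat F t).2.2.2 - (mat F t).2.1 * (mat F t).2.2.1 = 1 := by
  obtain ⟨e, _ | a, d⟩ := t
  · simp [mat, une F e]
  · refine ⟨a.2, div_mem (sub_mem (mul_mem a.2 d.2) (one_mem _)) e.1.2, e.1.2, d.2, ?_⟩
    have := une F e
    simp only [mat]
    field_simp
    ring

/-- Negation on the parameters. -/
def ng (t : Fˣ × Option F × F) : Fˣ × Option F × F := (-t.1, t.2.1.map (fun x => -x), -t.2.2)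

lemma mat_inj (s t : Fˣ × Option F × F) (h1 : (mat F s).1 = (mat F t).1)
    (h2 : (mat F s).2.1 = (mat F t).2.1) (h3 : (mat F s).2.2.1 = (mat F t).2.2.1)
    (h4 : (mat F s).2.2.2 = (mat F t).2.2.2) : s = t := by
  obtain ⟨e, _ | a, d⟩ := s <;> obtain ⟨e', _ | a', d'⟩ := t <;> simp only [mat] at h1 h2 h3 h4
  · simp only [Prod.mk.injEq, true_and]
    exact ⟨Units.ext (Subtype.ext h1), Subtype.ext h2⟩
  · exact absurd h3.symm (une F e')
  · exact absurd h3 (une F e)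
  · simp only [Prod.mk.injEq, Option.some.injEq]
    exact ⟨Units.ext (Subtype.ext h3), Subtype.ext h1, Subtype.ext h4⟩

lemma mat_ng (t : Fˣ × Option F × F) : mat F (ng F t) = -mat F t := by
  obtain ⟨e, _ | a, d⟩ := t
  · simp [mat, ng, inv_neg]
  · simp [mat, ng, div_neg]

lemma card_ge [Fintype F] (G : Subgroup (RatFunc k ≃ₐ[k] RatFunc k)) [Finite G]
    (hG : ∀ g : RatFunc k ≃ₐ[k] RatFunc k,
      g ∈ G ↔ ∃ a b c d : k, a ∈ F ∧ b ∈ F ∧ c ∈ F ∧ d ∈ F ∧ a * d - b * c = 1 ∧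
        g RatFunc.X = (RatFunc.C a * RatFunc.X + RatFunc.C b) /
          (RatFunc.C c * RatFunc.X + RatFunc.C d)) :
    (Fintype.card F - 1) * ((Fintype.card F + 1) * Fintype.card F) ≤ 2 * Nat.card G := by
  classical
  have := Fintype.ofFinite G
  have ex : ∀ t : Fˣ × Option F × F, ∃ g : G, g.1 RatFunc.X =
      (RatFunc.C (mat F t).1 * RatFunc.X + RatFunc.C (mat F t).2.1) /
          (RatFunc.C (mat F t).2.2.1 * RatFunc.X + RatFunc.C (mat F t).2.2.2) := by
    intro t
    obtain ⟨h1, h2, h3, h4, h5⟩ := mat_spec F t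
    obtain ⟨g, hg⟩ := exists_aut h5
    exact ⟨⟨g, (hG g).2 ⟨_, _, _, _, h1, h2, h3, h4, h5, hg⟩⟩, hg⟩
  choose φ hφ using ex
  have hfib : ∀ s t, φ s = φ t → t = s ∨ t = ng F s := by
    intro s t h
    have e := hφ s
    rw [h, hφ t] at e
    rcases sign (mat_spec F s).2.2.2.2 (mat_spec F t).2.2.2.2 e.symm with ⟨h1, h2, h3, h4⟩ | ⟨h1, h2, h3, h4⟩
    · left; exact mat_inj F _ _ h1 h2 h3 h4
    · right
      apply mat_inj F <;> rw [mat_ng] <;> assumption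
  have hc := Finset.card_le_mul_card_image (f := φ) Finset.univ 2 (by
    intro g hg
    obtain ⟨s, -, rfl⟩ := Finset.mem_image.1 hg
    refine (Finset.card_le_card (t := {s, ng F s}) ?_).trans Finset.card_le_two
    intro t ht
    have := hfib s t (Finset.mem_filter.1 ht).2.symm
    simpa using this)
  have h2 : (Finset.univ.image φ).card ≤ Nat.card G := by
    rw [Nat.card_eq_fintype_card]; exact Finset.card_le_univ _
  have h3 : (Finset.univ : Finset (Fˣ × Option F × F)).card =
      (Fintype.card F - 1) * ((Fintype.card F + 1) * Fintype.card F) := by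
    rw [Finset.card_univ, Fintype.card_prod, Fintype.card_prod, Fintype.card_option,
      Fintype.card_units]
  rw [← h3]
  exact hc.trans (Nat.mul_le_mul_left 2 h2)
end count

open Polynomial in
lemma degs {k : Type*} [Field k] (n : ℕ) (hn : 1 ≤ n) (z : RatFunc k)
    (hz : z = ((((RatFunc.X : RatFunc k) ^ (2 * n + 1) - RatFunc.X) ^ (2 * n) + 1) ^ (n + 1)) /
          (((RatFunc.X : RatFunc k) ^ (2 * n + 1) - RatFunc.X) ^ ((2 * n + 1) * n))) :
    0 < max z.num.natDegree z.denom.natDegree ∧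
     max z.num.natDegree z.denom.natDegree ≤ (2 * n + 1) * (2 * n) * (n + 1) := by
  set u : k[X] := X ^ (2 * n + 1) - X with hu
  have du : u.natDegree = 2 * n + 1 := FiniteField.X_pow_card_sub_X_natDegree_eq k (by lia)
  have u0 : u ≠ 0 := by rintro h; simp [h] at du
  have dN : (u ^ (2 * n) + 1).natDegree = 2 * n * (2 * n + 1) := by
    rw [← C_1, natDegree_add_C, natDegree_pow, du]
  have N0 : (u ^ (2 * n) + 1) ≠ 0 := by
    rintro h; rw [h] at dN; simp at dN; lia
  have hz' : z = algebraMap k[X] (RatFunc k) ((u ^ (2 * n) + 1) ^ (n + 1)) /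
      algebraMap k[X] (RatFunc k) (u ^ ((2 * n + 1) * n)) := by
    rw [hz, hu]; simp
  have uu : (u ^ ((2 * n + 1) * n)) ≠ 0 := pow_ne_zero _ u0
  have d1 : ((u ^ (2 * n) + 1) ^ (n + 1)).natDegree = (2 * n + 1) * (2 * n) * (n + 1) := by
    rw [natDegree_pow, dN]; ring
  have d2 : (u ^ ((2 * n + 1) * n)).natDegree = (2 * n + 1) * (2 * n + 1) * n := by
    rw [natDegree_pow, du]; ring
  constructor
  · rw [Nat.pos_iff_ne_zero]
    intro h0
    rw [Nat.max_eq_zero_iff, ← RatFunc.eq_C_iff] at h0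
    obtain ⟨c, hc⟩ := h0
    rw [hz', div_eq_iff ((map_ne_zero_iff _ (RatFunc.algebraMap_injective k)).2 uu),
      ← RatFunc.algebraMap_C, ← map_mul] at hc
    have h1 := RatFunc.algebraMap_injective k hc
    have h2 := congrArg natDegree h1
    rw [d1] at h2
    have h3 := natDegree_C_mul_le c (u ^ ((2 * n + 1) * n))
    rw [← h2, d2] at h3
    nlinarith
  · apply max_le
    · rw [← d1, hz']
      exact natDegree_le_of_dvd (RatFunc.num_div_dvd _ uu) (pow_ne_zero _ N0)
    · refine le_trans (b := (u ^ ((2 * n + 1) * n)).natDegree) ?_ ?_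
      · rw [hz']
        exact natDegree_le_of_dvd (RatFunc.denom_div_dvd _ _) uu
      · rw [d2]; nlinarith
end PSLAux

/-- Let `p` be an odd prime, `q = p^r`, and let `k` be an algebraically
closed field of characteristic `p` containing the finite field `F_q` with `q` elements
(realized as a subfield `F ⊆ k` with `q` elements).  Let `G` be the group of `k`-algebra
automorphisms of `k(x)` induced by all Möbius substitutions `x ↦ (ax+b)/(cx+d)` with
`a,b,c,d ∈ F_q` and `ad − bc = 1` (so `G ≅ PSL₂(q)`; an automorphism of `k(x)` over `k`
is determined by its value on `x`, so `G` is described by the membership condition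
below).  Then the fixed field of `G` acting on `k(x)` equals `k(z)`, where
`z = ((x^q − x)^{q−1} + 1)^{(q+1)/2} / (x^q − x)^{q(q−1)/2}`. -/
theorem fixedField_PSL2_eq_adjoin
    (k : Type*) [Field k] [IsAlgClosed k] (p : ℕ) [CharP k p]
    (hp : p.Prime) (hodd : Odd p) (r : ℕ) (q : ℕ) (hq : q = p ^ r)
    (F : Subfield k) [Fintype F] (hF : Fintype.card F = q)
    (G : Subgroup (RatFunc k ≃ₐ[k] RatFunc k))
    (hG : ∀ g : RatFunc k ≃ₐ[k] RatFunc k,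
      g ∈ G ↔ ∃ a b c d : k, a ∈ F ∧ b ∈ F ∧ c ∈ F ∧ d ∈ F ∧ a * d - b * c = 1 ∧
        g RatFunc.X = (RatFunc.C a * RatFunc.X + RatFunc.C b) /
          (RatFunc.C c * RatFunc.X + RatFunc.C d)) :
    IntermediateField.fixedField G =
      IntermediateField.adjoin k
        {((((RatFunc.X : RatFunc k) ^ q - RatFunc.X) ^ (q - 1) + 1) ^ ((q + 1) / 2)) /
          (((RatFunc.X : RatFunc k) ^ q - RatFunc.X) ^ (q * (q - 1) / 2))} := by
  classical
  obtain ⟨n, hn⟩ : Odd q := hq ▸ hodd.pow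
  have hn1 : 1 ≤ n := by
    have : 1 < Fintype.card F := Fintype.one_lt_card
    lia
  subst hn
  have e1 : (2 * n + 1 + 1) / 2 = n + 1 := by lia
  have e2 : 2 * n + 1 - 1 = 2 * n := by lia
  have e3 : (2 * n + 1) * (2 * n) / 2 = (2 * n + 1) * n := by
    rw [show (2 * n + 1) * (2 * n) = 2 * ((2 * n + 1) * n) by ring]
    exact Nat.mul_div_cancel_left _ two_pos
  rw [e2, e1, e3]
  generalize hz : ((((RatFunc.X : RatFunc k) ^ (2 * n + 1) - RatFunc.X) ^ (2 * n) + 1) ^ (n + 1)) /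
          (((RatFunc.X : RatFunc k) ^ (2 * n + 1) - RatFunc.X) ^ ((2 * n + 1) * n)) = z
  obtain ⟨hpos, hle⟩ := PSLAux.degs n hn1 z hz.symm
  rw [← RatFunc.finrank_eq_max_natDegree] at hpos hle
  have hfd : FiniteDimensional (IntermediateField.adjoin k {z}) (RatFunc k) :=
    FiniteDimensional.of_finrank_pos hpos
  have hu : (RatFunc.X : RatFunc k) ^ (2 * n + 1) - RatFunc.X ≠ 0 := by
    intro h
    have hz0 : z = 0 := by
      rw [← hz, h, zero_pow (by positivity : (2 * n + 1) * n ≠ 0), div_zero]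
    have := RatFunc.finrank_eq_max_natDegree z
    rw [hz0] at this hpos
    simp [this] at hpos
  have hpow : ∀ a ∈ F, a ^ (2 * n + 1) = a := by
    intro a ha
    have := FiniteField.pow_card (⟨a, ha⟩ : F)
    rw [hF] at this
    exact congrArg Subtype.val this
  have hsub : IntermediateField.adjoin k {z} ≤ IntermediateField.fixedField G := by
    rw [IntermediateField.adjoin_simple_le_iff, IntermediateField.mem_fixedField_iff]
    intro g hg
    obtain ⟨a, b, c, d, ha, hb, hc, hd, h, hgX⟩ := (hG g).1 hg
    rw [← hz]
    exact PSLAux.inv_aut p hp r n hq a b c d (hpow a ha) (hpow b hb) (hpow c hc) (hpow d hd) h hu g hgX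
  have hGle : G ≤ (IntermediateField.adjoin k {z}).fixingSubgroup :=
    (IntermediateField.le_iff_le _ _).1 hsub
  have hfin0 : Finite (IntermediateField.adjoin k {z}).fixingSubgroup :=
    Finite.of_equiv _ (IntermediateField.fixingSubgroupEquiv _).toEquiv.symm
  have hfin : Finite G := Finite.of_injective _ (Subgroup.inclusion_injective hGle)
  have hcard := PSLAux.card_ge F G hG
  have hrank : Module.finrank (IntermediateField.fixedField G) (RatFunc k) = Nat.card G := by
    have := Fintype.ofFinite G
    rw [Nat.card_eq_fintype_card]
    exact FixedPoints.finrank_eq_card G (RatFunc k)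
  symm
  apply IntermediateField.eq_of_le_of_finrank_le' hsub
  rw [hrank]
  refine hle.trans ?_
  rw [hF, e2] at hcard
  nlinarith
end

section
/- Let p be an odd prime, q = p^r, and let k be an algebraically closed field of characteristic p containing the finite field F_q with q elements. Let G be the group of k-algebra automorphisms of k(x) induced by all Möbius substitutions x ↦ (ax+b)/(cx+d) with a,b,c,d ∈ F_q and ad − bc ≠ 0 (so G ≅ PGL₂(q)). Then the fixed field of G acting on k(x) equals k(z), the subfield generated over k by z = ((x^q − x)^{q−1} + 1)^{q+1} / (x^q − x)^{q(q−1)}. -/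
open RatFunc Polynomial in
lemma quad_eq_zero {k : Type*} [Field k] {u v w : k}
    (h : RatFunc.C u * RatFunc.X ^ 2 + RatFunc.C v * RatFunc.X + RatFunc.C w = (0 : RatFunc k)) :
    u = 0 ∧ v = 0 ∧ w = 0 := by
  have h2 : (Polynomial.C u * Polynomial.X ^ 2 + Polynomial.C v * Polynomial.X + Polynomial.C w
      : Polynomial k) = 0 := by
    apply RatFunc.algebraMap_injective k
    simpa using h
  refine ⟨?_, ?_, ?_⟩
  · simpa [coeff_X, coeff_C] using congrArg (fun f => Polynomial.coeff f 2) h2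
  · simpa [coeff_X, coeff_C] using congrArg (fun f => Polynomial.coeff f 1) h2
  · simpa [coeff_X, coeff_C] using congrArg (fun f => Polynomial.coeff f 0) h2

lemma lin_eq_zero {k : Type*} [Field k] {v w : k}
    (h : RatFunc.C v * RatFunc.X + RatFunc.C w = (0 : RatFunc k)) :
    v = 0 ∧ w = 0 :=
  (quad_eq_zero (u := 0) (by simpa using h)).2

lemma den_ne {k : Type*} [Field k] {a b c d : k} (h : a * d - b * c ≠ 0) :
    (RatFunc.C c * RatFunc.X + RatFunc.C d : RatFunc k) ≠ 0 := by
  intro h0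
  obtain ⟨rfl, rfl⟩ := lin_eq_zero h0
  simp at h

open Polynomial nonZeroDivisors in
lemma exists_moebius {k : Type*} [Field k] {a b c d : k} (h : a * d - b * c ≠ 0) :
    ∃ g : RatFunc k ≃ₐ[k] RatFunc k, g RatFunc.X = (RatFunc.C a * RatFunc.X + RatFunc.C b) /
          (RatFunc.C c * RatFunc.X + RatFunc.C d) := by
  have hB := den_ne h
  set m : RatFunc k := (RatFunc.C a * RatFunc.X + RatFunc.C b) /
          (RatFunc.C c * RatFunc.X + RatFunc.C d) with hm
  have hnc : ¬ ∃ e, m = RatFunc.C e := by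
    rintro ⟨e, he⟩
    rw [hm, div_eq_iff hB] at he
    have := lin_eq_zero (v := a - e * c) (w := b - e * d) (by
      simp only [map_sub, map_mul]
      linear_combination he)
    apply h
    linear_combination d * this.1 - c * this.2
  have htr := RatFunc.transcendental_of_ne_C m hnc
  have hinj : Function.Injective (aeval m : k[X] →ₐ[k] RatFunc k) :=
    transcendental_iff_injective.mp htr
  have hle : (k[X])⁰ ≤ (RatFunc k)⁰.comap (aeval m : k[X] →ₐ[k] RatFunc k) :=
    nonZeroDivisors_le_comap_nonZeroDivisors_of_injective _ hinj
  let φ : RatFunc k →ₐ[k] RatFunc k := RatFunc.liftAlgHom (aeval m) hle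
  have hφX : φ RatFunc.X = m := by
    have := RatFunc.liftAlgHom_apply_div (aeval m : k[X] →ₐ[k] RatFunc k) hle Polynomial.X 1
    simpa [φ] using this
  have hC : ∀ e : k, RatFunc.C e ∈ φ.fieldRange := fun e => by
    have := φ.fieldRange.algebraMap_mem e
    simpa [RatFunc.algebraMap_eq_C] using this
  have hmem : m ∈ φ.fieldRange := ⟨RatFunc.X, hφX⟩
  have hX : RatFunc.X ∈ φ.fieldRange := by
    have hdet : (RatFunc.C (a * d - b * c) : RatFunc k) ≠ 0 :=
      (_root_.map_ne_zero RatFunc.C).mpr h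
    have hne : RatFunc.C a - RatFunc.C c * m ≠ 0 := by
      intro h0
      rw [hm] at h0
      field_simp at h0
      apply hdet
      simp only [map_sub, map_mul]
      linear_combination h0
    have : RatFunc.X = (RatFunc.C d * m - RatFunc.C b) / (RatFunc.C a - RatFunc.C c * m) := by
      have hmB : m * (RatFunc.C c * RatFunc.X + RatFunc.C d) =
          RatFunc.C a * RatFunc.X + RatFunc.C b := by
        rw [hm, div_mul_cancel₀ _ hB]
      rw [eq_div_iff hne]
      linear_combination -hmB
    rw [this]
    exact div_mem (sub_mem (mul_mem (hC _) hmem) (hC _)) (sub_mem (hC _) (mul_mem (hC _) hmem))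
  have htop : φ.fieldRange = ⊤ := by
    rw [eq_top_iff, ← RatFunc.adjoin_X, IntermediateField.adjoin_le_iff]
    simpa using hX
  refine ⟨AlgEquiv.ofBijective φ ⟨φ.injective, ?_⟩, hφX⟩
  exact AlgHom.fieldRange_eq_top.mp htop

/-- values of the Moebius maps, parametrized without repetition -/
noncomputable def moebVal {k : Type*} [Field k] (F : Subfield k) :
    F × Fˣ × Option F → RatFunc k
  | (a, e, none) => RatFunc.C (e : F).1 * RatFunc.X + RatFunc.C a.1
  | (a, e, some d) => RatFunc.C a.1 + RatFunc.C (e : F).1 / (RatFunc.X + RatFunc.C d.1)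

lemma X_add_ne {k : Type*} [Field k] (d : k) : (RatFunc.X + RatFunc.C d : RatFunc k) ≠ 0 := by
  have := den_ne (a := 1) (b := 0) (c := 1) (d := d)
  intro h
  have := lin_eq_zero (v := 1) (w := d) (by simpa using h)
  simp at this

lemma moebVal_mixed {k : Type*} [Field k] (e a d a' e' : k) (he : e ≠ 0)
    (h : RatFunc.C e * RatFunc.X + RatFunc.C a =
      (RatFunc.C a' + RatFunc.C e' / (RatFunc.X + RatFunc.C d) : RatFunc k)) : False := by
  have hd := X_add_ne d
  field_simp at h
  have := quad_eq_zero (u := e) (v := e * d + a - a') (w := a * d - a' * d - e') (by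
    simp only [map_sub, map_mul, map_add]
    linear_combination h)
  exact he this.1

lemma moebVal_injective {k : Type*} [Field k] (F : Subfield k) :
    Function.Injective (moebVal F) := by
  rintro ⟨a, e, _ | d⟩ ⟨a', e', _ | d'⟩ h
  · have := lin_eq_zero (v := (e : F).1 - (e' : F).1) (w := a.1 - a'.1) (by
      simp only [moebVal] at h
      simp only [map_sub]
      linear_combination h)
    have h1 : e = e' := Units.ext (Subtype.ext (sub_eq_zero.mp this.1))
    have h2 : a = a' := Subtype.ext (sub_eq_zero.mp this.2)
    rw [h1, h2]
  · exact (moebVal_mixed _ _ _ _ _ (by simp) h).elim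
  · exact (moebVal_mixed _ _ _ _ _ (by simp) h.symm).elim
  · simp only [moebVal] at h
    have hd := X_add_ne d.1
    have hd' := X_add_ne d'.1
    have he : (e : F).1 ≠ 0 := by simp
    rw [← sub_eq_zero] at h
    field_simp at h
    have := quad_eq_zero (u := a.1 - a'.1)
      (v := (a.1 - a'.1) * (d.1 + d'.1) + (e : F).1 - (e' : F).1)
      (w := (a.1 - a'.1) * (d.1 * d'.1) + (e : F).1 * d'.1 - (e' : F).1 * d.1) (by
        simp only [map_sub, map_mul, map_add]
        linear_combination h)
    obtain ⟨h1, h2, h3⟩ := this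
    rw [h1] at h2 h3
    have h4 : (e : F).1 = (e' : F).1 := by linear_combination h2
    have h5 : d = d' := by
      apply Subtype.ext
      rw [← h4] at h3
      apply mul_left_cancel₀ he
      linear_combination -h3
    have h6 : e = e' := Units.ext (Subtype.ext h4)
    have h7 : a = a' := Subtype.ext (sub_eq_zero.mp h1)
    rw [h5, h6, h7]

lemma moebVal_moebius {k : Type*} [Field k] (F : Subfield k) (t : F × Fˣ × Option F) :
    ∃ a b c d : k, a ∈ F ∧ b ∈ F ∧ c ∈ F ∧ d ∈ F ∧ a * d - b * c ≠ 0 ∧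
        moebVal F t = (RatFunc.C a * RatFunc.X + RatFunc.C b) /
          (RatFunc.C c * RatFunc.X + RatFunc.C d) := by
  obtain ⟨a, e, _ | d⟩ := t
  · refine ⟨(e : F).1, a.1, 0, 1, (e : F).2, a.2, F.zero_mem, F.one_mem, by simp, ?_⟩
    simp [moebVal]
  · refine ⟨a.1, a.1 * d.1 + (e : F).1, 1, d.1, a.2, F.add_mem (F.mul_mem a.2 d.2) (e : F).2,
      F.one_mem, d.2, ?_, ?_⟩
    · have he : (e : F).1 ≠ 0 := by simp
      intro h
      apply he
      linear_combination -h
    · have hd := X_add_ne d.1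
      simp only [moebVal, map_one, one_mul, map_add, map_mul]
      field_simp
      ring

lemma le_finrank {k : Type*} [Field k] (F : Subfield k) [Fintype F]
    (G : Subgroup (RatFunc k ≃ₐ[k] RatFunc k))
    (hG : ∀ g : RatFunc k ≃ₐ[k] RatFunc k,
      g ∈ G ↔ ∃ a b c d : k, a ∈ F ∧ b ∈ F ∧ c ∈ F ∧ d ∈ F ∧ a * d - b * c ≠ 0 ∧
        g RatFunc.X = (RatFunc.C a * RatFunc.X + RatFunc.C b) /
          (RatFunc.C c * RatFunc.X + RatFunc.C d))
    (hE : IntermediateField.fixedField G ≠ ⊥) :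
    Fintype.card F * ((Fintype.card F - 1) * (Fintype.card F + 1)) ≤
      Module.finrank (IntermediateField.fixedField G) (RatFunc k) := by
  classical
  set E := IntermediateField.fixedField G with hEdef
  have hint := (RatFunc.IntermediateField.isAlgebraic_X hE).isIntegral
  rw [← (RatFunc.IntermediateField.adjoinXEquiv E).toLinearEquiv.finrank_eq,
    IntermediateField.adjoin.finrank hint]
  set P := minpoly E (RatFunc.X : RatFunc k) with hP
  have hP0 : P ≠ 0 := minpoly.ne_zero hint
  have hroot : ∀ t, Polynomial.aeval (moebVal F t) P = 0 := by
    intro t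
    obtain ⟨a, b, c, d, ha, hb, hc, hd, hdet, ht⟩ := moebVal_moebius F t
    obtain ⟨g, hg⟩ := exists_moebius hdet
    have hgG : g ∈ G := (hG g).2 ⟨a, b, c, d, ha, hb, hc, hd, hdet, hg⟩
    rw [ht, ← hg]
    have h0 : Polynomial.eval₂ (algebraMap E (RatFunc k)) RatFunc.X P = 0 := minpoly.aeval E _
    have h1 := Polynomial.hom_eval₂ P (algebraMap E (RatFunc k)) (g : RatFunc k →+* RatFunc k)
      RatFunc.X
    have h2 : (g : RatFunc k →+* RatFunc k).comp (algebraMap E (RatFunc k)) =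
        algebraMap E (RatFunc k) := by
      ext1 y
      exact y.2 ⟨g, hgG⟩
    rw [h0, h2, map_zero] at h1
    exact h1.symm
  have hcard : Fintype.card (F × Fˣ × Option F) ≤ P.natDegree := by
    rw [← Finset.card_univ, ← Finset.card_image_of_injective _ (moebVal_injective F)]
    refine le_trans (Finset.card_le_card (t := (P.aroots (RatFunc k)).toFinset) ?_) ?_
    · intro y hy
      obtain ⟨t, -, rfl⟩ := Finset.mem_image.mp hy
      rw [Multiset.mem_toFinset, Polynomial.mem_aroots]
      exact ⟨hP0, hroot t⟩
    · refine (Multiset.toFinset_card_le _).trans ?_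
      refine (Polynomial.card_roots' _).trans ?_
      exact Polynomial.natDegree_map_le
  rw [Fintype.card_prod, Fintype.card_prod, Fintype.card_option, Fintype.card_units] at hcard
  exact hcard

lemma frob_moeb {K : Type*} [Field K] {x a b c d : K} (N : ℕ)
    (hB : c * x + d ≠ 0)
    (hA' : (a * x + b) ^ N = a * x ^ N + b) (hB' : (c * x + d) ^ N = c * x ^ N + d) :
    ((a * x + b) / (c * x + d)) ^ N - (a * x + b) / (c * x + d) =
      (a * d - b * c) * (x ^ N - x) / (c * x + d) ^ (N + 1) := by
  rw [div_pow, pow_succ, div_sub_div _ _ (pow_ne_zero _ hB) hB, hA', hB']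
  congr 1
  ring

lemma z_eq {K : Type*} [Field K] {w v : K} {q : ℕ} (hq : 1 ≤ q) (hw : w ≠ 0)
    (hv : v = w ^ q + w) :
    (w ^ (q - 1) + 1) ^ (q + 1) / w ^ (q * (q - 1)) = v ^ (q + 1) / w ^ (q ^ 2 + 1) := by
  obtain ⟨n, rfl⟩ : ∃ n, q = n + 1 := ⟨q - 1, by omega⟩
  have : v = w * (w ^ n + 1) := by rw [hv]; ring
  rw [this, Nat.add_sub_cancel, div_eq_div_iff (pow_ne_zero _ hw) (pow_ne_zero _ hw), mul_pow]
  generalize (w ^ n + 1) = u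
  ring

open Polynomial in
theorem fixedField_PGL2_eq_adjoin
    (k : Type*) [Field k] [IsAlgClosed k] (p : ℕ) [CharP k p]
    (hp : p.Prime) (hodd : Odd p) (r : ℕ) (q : ℕ) (hq : q = p ^ r)
    (F : Subfield k) [Fintype F] (hF : Fintype.card F = q)
    (G : Subgroup (RatFunc k ≃ₐ[k] RatFunc k))
    (hG : ∀ g : RatFunc k ≃ₐ[k] RatFunc k,
      g ∈ G ↔ ∃ a b c d : k, a ∈ F ∧ b ∈ F ∧ c ∈ F ∧ d ∈ F ∧ a * d - b * c ≠ 0 ∧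
        g RatFunc.X = (RatFunc.C a * RatFunc.X + RatFunc.C b) /
          (RatFunc.C c * RatFunc.X + RatFunc.C d)) :
    IntermediateField.fixedField G =
      IntermediateField.adjoin k
        {((((RatFunc.X : RatFunc k) ^ q - RatFunc.X) ^ (q - 1) + 1) ^ (q + 1)) /
          (((RatFunc.X : RatFunc k) ^ q - RatFunc.X) ^ (q * (q - 1)))} := by
  have hq2 : 2 ≤ q := by rw [← hF]; exact Fintype.one_lt_card
  haveI : Fact p.Prime := ⟨hp⟩
  haveI : CharP (RatFunc k) p := charP_of_injective_algebraMap (algebraMap k (RatFunc k)).injective p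
  set z : RatFunc k := ((((RatFunc.X : RatFunc k) ^ q - RatFunc.X) ^ (q - 1) + 1) ^ (q + 1)) /
          (((RatFunc.X : RatFunc k) ^ q - RatFunc.X) ^ (q * (q - 1))) with hz
  -- polynomial facts
  set W : k[X] := X ^ q - X with hW
  have hWdeg : W.natDegree = q := by
    rw [hW]; exact FiniteField.X_pow_card_sub_X_natDegree_eq k (by omega)
  have hW0 : W ≠ 0 := by intro h; rw [h] at hWdeg; simp at hWdeg; omega
  have hWmap : algebraMap k[X] (RatFunc k) W = (RatFunc.X : RatFunc k) ^ q - RatFunc.X := by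
    simp [hW]
  have hw0 : (RatFunc.X : RatFunc k) ^ q - RatFunc.X ≠ 0 := by
    rw [← hWmap]; exact RatFunc.algebraMap_ne_zero hW0
  have hzPQ : z = algebraMap k[X] (RatFunc k) ((W ^ (q - 1) + 1) ^ (q + 1)) /
      algebraMap k[X] (RatFunc k) (W ^ (q * (q - 1))) := by
    rw [hz, ← hWmap]; simp
  have hpos : 0 < (W ^ (q - 1)).natDegree := by
    rw [natDegree_pow, hWdeg]
    exact Nat.mul_pos (by omega) (by omega)
  have hPdeg : ((W ^ (q - 1) + 1) ^ (q + 1)).natDegree = q * ((q - 1) * (q + 1)) := by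
    rw [natDegree_pow, ← C_1, natDegree_add_C, natDegree_pow, hWdeg]; ring
  have hQdeg : (W ^ (q * (q - 1))).natDegree = q * ((q - 1) * q) := by
    rw [natDegree_pow, hWdeg]; ring
  have hlt : q * ((q - 1) * q) < q * ((q - 1) * (q + 1)) := by
    have : 0 < q - 1 := by omega
    have : 0 < q := by omega
    gcongr; omega
  have hP0 : (W ^ (q - 1) + 1) ^ (q + 1) ≠ 0 := by
    intro h; rw [h, natDegree_zero] at hPdeg; omega
  have hQ0 : W ^ (q * (q - 1)) ≠ 0 := pow_ne_zero _ hW0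
  have hznc : ¬ ∃ c, z = RatFunc.C c := by
    rintro ⟨c, hc⟩
    rw [hzPQ, div_eq_iff (RatFunc.algebraMap_ne_zero hQ0), ← RatFunc.algebraMap_C, ← map_mul] at hc
    have h1 := RatFunc.algebraMap_injective k hc
    have h2 := natDegree_C_mul_le c (W ^ (q * (q - 1)))
    rw [← h1] at h2
    omega
  have hfin : Module.finrank (IntermediateField.adjoin k {z}) (RatFunc k) ≤
      q * ((q - 1) * (q + 1)) := by
    rw [RatFunc.finrank_eq_max_natDegree]
    apply max_le
    · rw [← hPdeg, hzPQ]
      exact natDegree_le_of_dvd (RatFunc.num_div_dvd _ hQ0) hP0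
    · refine le_trans ?_ hlt.le
      rw [← hQdeg, hzPQ]
      exact natDegree_le_of_dvd (RatFunc.denom_div_dvd _ _) hQ0
  have hfinpos : 0 < Module.finrank (IntermediateField.adjoin k {z}) (RatFunc k) := by
    rw [RatFunc.finrank_eq_max_natDegree]
    by_contra h0
    have h1 : max z.num.natDegree z.denom.natDegree = 0 := by omega
    rw [Nat.max_eq_zero_iff, ← RatFunc.eq_C_iff] at h1
    exact hznc h1
  -- invariance
  have hFq : ∀ a ∈ F, a ^ q = a := by
    intro a ha
    have := FiniteField.pow_card (⟨a, ha⟩ : F)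
    rw [hF] at this
    exact congrArg Subtype.val this
  have hlin : ∀ (a b : k), a ∈ F → b ∈ F → ∀ y : RatFunc k,
      (RatFunc.C a * y + RatFunc.C b) ^ q = RatFunc.C a * y ^ q + RatFunc.C b := by
    intro a b ha hb y
    have h1 := hFq a ha
    have h2 := hFq b hb
    rw [hq] at h1 h2 ⊢
    rw [add_pow_char_pow, mul_pow, ← map_pow, ← map_pow, h1, h2]
  have hlin2 : ∀ (a b : k), a ∈ F → b ∈ F → ∀ y : RatFunc k,
      (RatFunc.C a * y + RatFunc.C b) ^ (q ^ 2) = RatFunc.C a * y ^ (q ^ 2) + RatFunc.C b := by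
    intro a b ha hb y
    rw [pow_two q, pow_mul, pow_mul, hlin a b ha hb, hlin a b ha hb]
  have hv : ∀ y : RatFunc k, y ^ (q ^ 2) - y = (y ^ q - y) ^ q + (y ^ q - y) := by
    intro y
    have : (y ^ q - y) ^ q = (y ^ q) ^ q - y ^ q := by
      rw [hq, sub_pow_char_pow]
    rw [this, pow_two q, pow_mul]; ring
  have hz' : z = ((RatFunc.X : RatFunc k) ^ (q ^ 2) - RatFunc.X) ^ (q + 1) /
      ((RatFunc.X : RatFunc k) ^ q - RatFunc.X) ^ (q ^ 2 + 1) :=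
    z_eq (by omega) hw0 (hv _)
  have hzmem : z ∈ IntermediateField.fixedField G := by
    rintro ⟨g, hg⟩
    change g z = z
    obtain ⟨a, b, c, d, ha, hb, hc, hd, hdet, hgX⟩ := (hG g).1 hg
    have hB := den_ne hdet
    set D : k := a * d - b * c with hD
    have hDF : D ∈ F := F.sub_mem (F.mul_mem ha hd) (F.mul_mem hb hc)
    have hDC : RatFunc.C a * RatFunc.C d - RatFunc.C b * RatFunc.C c = RatFunc.C D := by
      rw [hD]; simp
    have hCD : RatFunc.C D ≠ 0 := by simpa using hdet
    have hCDq : RatFunc.C D ^ q = RatFunc.C D := by rw [← map_pow, hFq D hDF]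
    have hCDq2 : RatFunc.C D ^ (q ^ 2) = RatFunc.C D := by rw [pow_two, pow_mul, hCDq, hCDq]
    rw [hz', map_div₀, map_pow, map_pow, map_sub, map_sub, map_pow, map_pow, hgX,
      frob_moeb q hB (hlin a b ha hb _) (hlin c d hc hd _),
      frob_moeb (q ^ 2) hB (hlin2 a b ha hb _) (hlin2 c d hc hd _), hDC,
      div_pow, div_pow, mul_pow, mul_pow, pow_succ (RatFunc.C D), hCDq,
      pow_succ (RatFunc.C D), hCDq2, ← pow_mul, ← pow_mul, mul_comm (q + 1) (q ^ 2 + 1),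
      div_div_div_cancel_right₀ (pow_ne_zero _ hB),
      mul_div_mul_left _ _ (mul_ne_zero hCD hCD)]
  have hle : IntermediateField.adjoin k {z} ≤ IntermediateField.fixedField G := by
    rw [IntermediateField.adjoin_le_iff]
    simpa using hzmem
  have hne : IntermediateField.fixedField G ≠ ⊥ := by
    intro h
    rw [h, IntermediateField.mem_bot] at hzmem
    obtain ⟨c, hc⟩ := hzmem
    exact hznc ⟨c, by rw [← hc, RatFunc.algebraMap_eq_C]⟩
  have hlow := le_finrank F G hG hne
  rw [hF] at hlow
  have htower := IntermediateField.relfinrank_mul_finrank_top hle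
  refine le_antisymm (IntermediateField.relfinrank_eq_one_iff.mp ?_) hle
  rw [← htower] at hfin hfinpos
  have h1 := Nat.pos_of_mul_pos_right hfinpos
  have h2 : 0 < Module.finrank (IntermediateField.fixedField G) (RatFunc k) := by
    exact Nat.pos_of_mul_pos_left hfinpos
  have h3 := hfin.trans hlow
  have h4 : IntermediateField.relfinrank (IntermediateField.adjoin k {z})
      (IntermediateField.fixedField G) ≤ 1 := by
    by_contra h5
    nlinarith
  exact le_antisymm h4 (Nat.pos_of_ne_zero (by rintro h0; simp [h0] at hfinpos))
end

section
/- Let k be an algebraically closed field of characteristic different from 2 and 3, and let ω ∈ k be a primitive cube root of unity. Let K = k(a₁, a₂) be the field of rational functions in two independent variables, and let G be the group of k-algebra automorphisms of K generated by τ₁ : (a₁, a₂) ↦ (ω·a₁, ω²·a₂) and τ₂ : (a₁, a₂) ↦ (a₂, a₁) (a dihedral group of order 6). Then the fixed field K^G equals k(s₁, s₂), the subfield generated over k by s₁ = a₁³ + a₂³ and s₂ = 2a₁a₂. -/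
open MvPolynomial

/-- Abstract averaging argument. -/
theorem mem_of_fixed_aux {k K : Type*} [Field k] [Field K] [Algebra k K]
    (h2 : (2 : K) ≠ 0) (h3 : (3 : K) ≠ 0) (w : k) (hw : w ^ 2 + w + 1 = 0)
    (F : IntermediateField k K) (a b : K) (s : K) (t : K) (hsF : s ∈ F) (htF : t ∈ F)
    (hs : s = a ^ 3 + b ^ 3) (ht : t = 2 * a * b) (ha : a ≠ 0)
    (τ₁ τ₂ : K ≃ₐ[k] K)
    (h11 : τ₁ a = algebraMap k K w * a) (h12 : τ₁ b = algebraMap k K (w ^ 2) * b)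
    (h21 : τ₂ a = b)
    (hF1 : ∀ c ∈ F, τ₁ c = c) (hF2 : ∀ c ∈ F, τ₂ c = c)
    (htop : ∀ L : IntermediateField k K, a ∈ L → b ∈ L → L = ⊤)
    (x : K) (hx1 : τ₁ x = x) (hx2 : τ₂ x = x) : x ∈ F := by
  set z : K := algebraMap k K w with hz
  have hz1 : z ^ 2 + z + 1 = 0 := by
    rw [hz, ← map_pow, ← map_add, ← map_one (algebraMap k K), ← map_add, hw, map_zero]
  have h12' : τ₁ b = z ^ 2 * b := by rw [h12, map_pow]
  have hzτ : τ₁ z = z := τ₁.commutes w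
  have h2F : (2 : K) ∈ F := by exact_mod_cast natCast_mem F 2
  have h3F : (3 : K) ∈ F := by exact_mod_cast natCast_mem F 3
  have hu : a * b ∈ F := by
    have : a * b = t / 2 := by rw [ht]; field_simp
    rw [this]; exact div_mem htF h2F
  have hrec : a ^ 6 = s * a ^ 3 - (a * b) ^ 3 := by rw [hs]; ring
  -- the trace
  let T : K → K := fun y =>
    y + τ₁ y + τ₁ (τ₁ y) + τ₂ y + τ₁ (τ₂ y) + τ₁ (τ₁ (τ₂ y))
  have Tadd : ∀ y y', T (y + y') = T y + T y' := by
    intro y y'; simp only [T, map_add]; ring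
  have Tsmul : ∀ c ∈ F, ∀ y, T (c * y) = c * T y := by
    intro c hc y; simp only [T, map_mul, hF1 c hc, hF2 c hc]; ring
  have hz3 : z ^ 3 = 1 := by linear_combination (z - 1) * hz1
  have Tpow : ∀ n, T (a ^ n) = (1 + z ^ n + z ^ (2 * n)) * (a ^ n + b ^ n) := by
    intro n
    have e4 : (z ^ n) ^ 3 = 1 := by rw [← pow_mul, mul_comm, pow_mul, hz3, one_pow]
    simp only [T, map_pow, map_mul, h11, h12', h21, hzτ, mul_pow]
    have : (z ^ 2) ^ n = (z ^ n) ^ 2 := by rw [← pow_mul, ← pow_mul, mul_comm]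
    have h' : z ^ (2 * n) = (z ^ n) ^ 2 := by rw [← pow_mul, mul_comm]
    rw [h', this]
    linear_combination (b ^ n * z ^ n) * e4
  have TpowF : ∀ n, T (a ^ n) ∈ F := by
    intro n
    induction n using Nat.strong_induction_on with
    | _ n ih =>
      by_cases hn : n < 6
      · rw [Tpow]
        have e1 : (1 + z + z ^ 2) = 0 := by linear_combination hz1
        interval_cases n
        · have : (1 + z ^ 0 + z ^ (2 * 0)) * (a ^ 0 + b ^ 0) = 3 * 2 := by ring
          rw [this]; exact mul_mem h3F h2F
        · have : (1 + z ^ 1 + z ^ (2 * 1)) * (a ^ 1 + b ^ 1) = 0 := by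
            linear_combination (a + b) * hz1
          rw [this]; exact zero_mem F
        · have : (1 + z ^ 2 + z ^ (2 * 2)) * (a ^ 2 + b ^ 2) = 0 := by
            linear_combination (a ^ 2 + b ^ 2) * (z ^ 2 - z + 1) * hz1
          rw [this]; exact zero_mem F
        · have : (1 + z ^ 3 + z ^ (2 * 3)) * (a ^ 3 + b ^ 3) = 3 * s := by
            rw [hs, pow_mul', hz3]; ring
          rw [this]; exact mul_mem h3F hsF
        · have : (1 + z ^ 4 + z ^ (2 * 4)) * (a ^ 4 + b ^ 4) = 0 := by
            linear_combination (a ^ 4 + b ^ 4) * (z ^ 4 - z ^ 2 + 1) * (z ^ 2 - z + 1) * hz1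
          rw [this]; exact zero_mem F
        · have : (1 + z ^ 5 + z ^ (2 * 5)) * (a ^ 5 + b ^ 5) = 0 := by
            linear_combination (a ^ 5 + b ^ 5) *
              (hz1 + z ^ 2 * hz3 + (z ^ 7 + z ^ 4 + z) * hz3)
          rw [this]; exact zero_mem F
      · obtain ⟨m, rfl⟩ : ∃ m, n = m + 6 := ⟨n - 6, by omega⟩
        have e : a ^ (m + 6) = s * a ^ (m + 3) + (-(a * b) ^ 3) * a ^ m := by
          rw [pow_add, hrec]; ring
        have hc : -(a * b) ^ 3 ∈ F := neg_mem (pow_mem hu 3)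
        rw [e, Tadd, Tsmul s hsF, Tsmul _ hc]
        exact add_mem (mul_mem hsF (ih _ (by omega))) (mul_mem hc (ih _ (by omega)))
  -- everything is a polynomial in a
  have hint : IsIntegral F a := by
    refine ⟨Polynomial.X ^ 6 - (Polynomial.C (⟨s, hsF⟩ : F) * Polynomial.X ^ 3
      - Polynomial.C (⟨a * b, hu⟩ ^ 3 : F)), ?_, ?_⟩
    · apply Polynomial.monic_X_pow_sub
      compute_degree!
    · simp only [Polynomial.eval₂_sub, Polynomial.eval₂_mul, Polynomial.eval₂_pow,
        Polynomial.eval₂_X, Polynomial.eval₂_C, map_pow]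
      change a ^ 6 - (s * a ^ 3 - (a * b) ^ 3) = 0
      rw [hrec, sub_self]
  have hmem : ∀ y : K, y ∈ IntermediateField.adjoin F {a} := by
    intro y
    have haL : a ∈ IntermediateField.adjoin F {a} :=
      IntermediateField.mem_adjoin_simple_self F a
    have := htop ((IntermediateField.adjoin F {a}).restrictScalars k) haL (by
      have hb : b = (a * b) / a := by field_simp
      rw [hb]
      exact div_mem ((IntermediateField.adjoin F {a}).algebraMap_mem ⟨a * b, hu⟩) haL)
    have hy : y ∈ (IntermediateField.adjoin F {a}).restrictScalars k := by
      rw [this]; trivial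
    exact hy
  have hTF : ∀ y, T y ∈ F := by
    intro y
    have hy := hmem y
    rw [← IntermediateField.mem_toSubalgebra,
      IntermediateField.adjoin_simple_toSubalgebra_of_isAlgebraic hint.isAlgebraic,
      Algebra.adjoin_singleton_eq_range_aeval] at hy
    obtain ⟨P, rfl⟩ := hy
    change T (Polynomial.aeval a P) ∈ F
    induction P using Polynomial.induction_on' with
    | add p q hp hq => rw [map_add, Tadd]; exact add_mem hp hq
    | monomial n c =>
      rw [Polynomial.aeval_monomial]
      change T ((c : K) * a ^ n) ∈ F
      rw [Tsmul _ c.2]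
      exact mul_mem c.2 (TpowF n)
  have hTx : T x = 2 * 3 * x := by
    simp only [T, hx1, hx2]; ring
  have : x = T x / (2 * 3) := by rw [hTx]; field_simp
  rw [this]
  exact div_mem (hTF x) (mul_mem h2F h3F)

/-- Let `k` be an algebraically closed field of characteristic
different from `2` and `3`, and let `ω ∈ k` be a primitive cube root of unity.  Let
`K = k(a₁, a₂)` be the field of rational functions in two independent variables, and let
`G` be the group of `k`-algebra automorphisms of `K` generated by
`τ₁ : (a₁, a₂) ↦ (ω·a₁, ω²·a₂)` and `τ₂ : (a₁, a₂) ↦ (a₂, a₁)` (a dihedral group of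
order `6`).  Then the fixed field `K^G` equals `k(s₁, s₂)`, the subfield generated over
`k` by `s₁ = a₁³ + a₂³` and `s₂ = 2a₁a₂`. -/
theorem fixedField_dihedral_genus_two_s_invariants
    (k : Type*) [Field k] [IsAlgClosed k] (p : ℕ) [CharP k p]
    (hp2 : p ≠ 2) (hp3 : p ≠ 3)
    (ω : k) (hω : IsPrimitiveRoot ω 3)
    (a₁ a₂ : FractionRing (MvPolynomial (Fin 2) k))
    (ha₁ : a₁ = algebraMap (MvPolynomial (Fin 2) k)
      (FractionRing (MvPolynomial (Fin 2) k)) (X 0))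
    (ha₂ : a₂ = algebraMap (MvPolynomial (Fin 2) k)
      (FractionRing (MvPolynomial (Fin 2) k)) (X 1))
    (τ₁ τ₂ : FractionRing (MvPolynomial (Fin 2) k) ≃ₐ[k]
      FractionRing (MvPolynomial (Fin 2) k))
    (hτ₁₁ : τ₁ a₁ = algebraMap k (FractionRing (MvPolynomial (Fin 2) k)) ω * a₁)
    (hτ₁₂ : τ₁ a₂ = algebraMap k (FractionRing (MvPolynomial (Fin 2) k)) (ω ^ 2) * a₂)
    (hτ₂₁ : τ₂ a₁ = a₂) (hτ₂₂ : τ₂ a₂ = a₁) :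
    IntermediateField.fixedField (Subgroup.closure {τ₁, τ₂}) =
      IntermediateField.adjoin k {a₁ ^ 3 + a₂ ^ 3, 2 * a₁ * a₂} := by
  have hk2 : (2 : k) ≠ 0 := by
    intro h
    have : p ∣ 2 := (CharP.cast_eq_zero_iff k p 2).1 (by exact_mod_cast h)
    rcases (Nat.dvd_prime Nat.prime_two).1 this with h1 | h1
    · exact CharP.char_ne_one k p h1
    · exact hp2 h1
  have hk3 : (3 : k) ≠ 0 := by
    intro h
    have : p ∣ 3 := (CharP.cast_eq_zero_iff k p 3).1 (by exact_mod_cast h)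
    rcases (Nat.dvd_prime Nat.prime_three).1 this with h1 | h1
    · exact CharP.char_ne_one k p h1
    · exact hp3 h1
  have hw3 : ω ^ 3 = 1 := hω.pow_eq_one
  have hw : ω ^ 2 + ω + 1 = 0 := by
    have h1 : ω - 1 ≠ 0 := sub_ne_zero.2 (hω.ne_one (by norm_num))
    apply mul_left_cancel₀ h1
    linear_combination hw3
  have hinj := FaithfulSMul.algebraMap_injective k (FractionRing (MvPolynomial (Fin 2) k))
  have hK2 : (2 : FractionRing (MvPolynomial (Fin 2) k)) ≠ 0 := by
    intro h; apply hk2; apply hinj; rw [map_ofNat, map_zero, h]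
  have hK3 : (3 : FractionRing (MvPolynomial (Fin 2) k)) ≠ 0 := by
    intro h; apply hk3; apply hinj; rw [map_ofNat, map_zero, h]
  have ha0 : a₁ ≠ 0 := by
    rw [ha₁]
    intro h
    exact X_ne_zero (R := k) (0 : Fin 2)
      ((IsFractionRing.injective (MvPolynomial (Fin 2) k)
        (FractionRing (MvPolynomial (Fin 2) k))) (by rw [h, map_zero]))
  have htop : ∀ L : IntermediateField k (FractionRing (MvPolynomial (Fin 2) k)),
      a₁ ∈ L → a₂ ∈ L → L = ⊤ := by
    intro L h1 h2
    rw [eq_top_iff]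
    intro x _
    have hpoly : ∀ q : MvPolynomial (Fin 2) k, algebraMap (MvPolynomial (Fin 2) k)
        (FractionRing (MvPolynomial (Fin 2) k)) q ∈ L := by
      intro q
      induction q using MvPolynomial.induction_on with
      | C c =>
        have := L.algebraMap_mem c
        rwa [IsScalarTower.algebraMap_apply k (MvPolynomial (Fin 2) k)] at this
      | add p q hp hq => rw [map_add]; exact add_mem hp hq
      | mul_X p i hp =>
        rw [map_mul]
        refine mul_mem hp ?_
        fin_cases i
        · exact ha₁ ▸ h1
        · exact ha₂ ▸ h2
    obtain ⟨u, v, _, rfl⟩ := IsFractionRing.div_surjective (A := MvPolynomial (Fin 2) k) x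
    exact div_mem (hpoly u) (hpoly v)
  have hz3 : (algebraMap k (FractionRing (MvPolynomial (Fin 2) k)) ω) ^ 3 = 1 := by
    rw [← map_pow, hw3, map_one]
  have hle : IntermediateField.adjoin k {a₁ ^ 3 + a₂ ^ 3, 2 * a₁ * a₂} ≤
      IntermediateField.fixedField (Subgroup.closure {τ₁, τ₂}) := by
    rw [IntermediateField.le_iff_le, Subgroup.closure_le]
    have key : ∀ τ : FractionRing (MvPolynomial (Fin 2) k) ≃ₐ[k]
        FractionRing (MvPolynomial (Fin 2) k),
        τ (a₁ ^ 3 + a₂ ^ 3) = a₁ ^ 3 + a₂ ^ 3 → τ (2 * a₁ * a₂) = 2 * a₁ * a₂ →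
        τ ∈ (IntermediateField.adjoin k {a₁ ^ 3 + a₂ ^ 3, 2 * a₁ * a₂}).fixingSubgroup := by
      intro τ e1 e2
      rw [← Subgroup.zpowers_le, ← IntermediateField.le_iff_le,
        IntermediateField.adjoin_le_iff]
      have : ∀ y, τ y = y → y ∈ IntermediateField.fixedField (Subgroup.zpowers τ) := by
        intro y hy
        rw [IntermediateField.mem_fixedField_iff]
        intro f hf
        have : Subgroup.zpowers τ ≤ MulAction.stabilizer _ y := by
          rw [Subgroup.zpowers_le]; exact hy
        exact this hf
      rintro y (rfl | rfl)
      · exact this _ e1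
      · exact this _ e2
    rintro τ (rfl | rfl)
    · apply key
      · rw [map_add, map_pow, map_pow, hτ₁₁, hτ₁₂, map_pow]
        linear_combination (a₁ ^ 3 + a₂ ^ 3 *
          (algebraMap k (FractionRing (MvPolynomial (Fin 2) k)) ω ^ 3 + 1)) * hz3
      · rw [map_mul, map_mul, map_ofNat, hτ₁₁, hτ₁₂, map_pow]
        linear_combination (2 * a₁ * a₂) * hz3
    · apply key
      · rw [map_add, map_pow, map_pow, hτ₂₁, hτ₂₂]; ring
      · rw [map_mul, map_mul, map_ofNat, hτ₂₁, hτ₂₂]; ring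
  have m1 : τ₁ ∈ Subgroup.closure {τ₁, τ₂} := Subgroup.subset_closure (by simp)
  have m2 : τ₂ ∈ Subgroup.closure {τ₁, τ₂} := Subgroup.subset_closure (by simp)
  refine le_antisymm ?_ hle
  intro x hx
  rw [IntermediateField.mem_fixedField_iff] at hx
  have hfix : ∀ c ∈ IntermediateField.adjoin k {a₁ ^ 3 + a₂ ^ 3, 2 * a₁ * a₂},
      ∀ f ∈ Subgroup.closure {τ₁, τ₂}, f c = c := fun c hc =>
    (IntermediateField.mem_fixedField_iff _ _).1 (hle hc)
  exact mem_of_fixed_aux hK2 hK3 ω hw _ a₁ a₂ (a₁ ^ 3 + a₂ ^ 3) (2 * a₁ * a₂)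
    (IntermediateField.subset_adjoin _ _ (by simp))
    (IntermediateField.subset_adjoin _ _ (by simp)) rfl rfl ha0 τ₁ τ₂ hτ₁₁ hτ₁₂ hτ₂₁
    (fun c hc => hfix c hc _ m1) (fun c hc => hfix c hc _ m2) htop x (hx _ m1) (hx _ m2)
end

section
/- Let k be an algebraically closed field of characteristic different from 2, and let i ∈ k satisfy i² = −1. Let K = k(a₁, a₂, a₃) be the field of rational functions in three independent variables, and let G be the group of k-algebra automorphisms of K generated by τ₁ : (a₁, a₂, a₃) ↦ (i·a₁, −a₂, −i·a₃) and τ₂ : (a₁, a₂, a₃) ↦ (a₃, a₂, a₁) (a dihedral group of order 8). Then the fixed field K^G equals k(s₁, s₂, s₃), the subfield generated over k by s₁ = a₁⁴ + a₃⁴, s₂ = (a₁² + a₃²)·a₂, and s₃ = 2a₁a₃. -/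
open MvPolynomial

theorem dih_distinct {K : Type*} [Field K] (I a b : K) (h2 : (2 : K) ≠ 0) (hI : I ^ 2 = -1)
    (ha : a ≠ 0) (hb : b ≠ 0) (h1 : a ≠ b) (h2' : a ≠ -b) (h3 : a ≠ I * b) (h4 : a ≠ -(I * b)) :
    Function.Injective ![a, I * a, -a, -(I * a), b, I * b, -b, -(I * b)] := by
  have hI0 : I ≠ 0 := by rintro rfl; simp at hI
  have e1 : I ≠ 1 := by rintro rfl; apply h2; linear_combination hI
  have e2 : I ≠ -1 := by rintro rfl; apply h2; linear_combination hI
  have n1 : ∀ c : K, c ≠ 0 → c ≠ I * c := fun c hc h => e1 (mul_right_cancel₀ hc (by linear_combination -h))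
  have n2 : ∀ c : K, c ≠ 0 → c ≠ -(I * c) := fun c hc h => e2 (mul_right_cancel₀ hc (by linear_combination h))
  have n3 : ∀ c : K, c ≠ 0 → c ≠ -c := fun c hc h => hc (by
    have : 2 * c = 0 := by linear_combination h
    simpa [h2] using this)
  have a1 := n1 a ha
  have a2 := n2 a ha
  have a3 := n3 a ha
  have a4 := n3 (I * a) (mul_ne_zero hI0 ha)
  have b1 := n1 b hb
  have b2 := n2 b hb
  have b3 := n3 b hb
  have b4 := n3 (I * b) (mul_ne_zero hI0 hb)
  have c1 : I * a ≠ I * b := fun h => h1 (mul_left_cancel₀ hI0 h)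
  have c2 : I * a ≠ -(I * b) := fun h => h2' (mul_left_cancel₀ hI0 (by linear_combination h))
  have c3 : I * a ≠ b := fun h => h4 (by linear_combination -I * h + a * hI)
  have c4 : I * a ≠ -b := fun h => h3 (by linear_combination -I * h + a * hI)
  rw [← List.nodup_ofFn]
  simp only [List.ofFn_succ, List.ofFn_zero, List.nodup_cons, List.mem_cons, Matrix.cons_val_zero,
    Matrix.cons_val_succ, List.not_mem_nil, List.nodup_nil, not_or, or_false, not_false_eq_true, and_true]
  clear n1 n2 n3 hI
  refine ⟨⟨?_, ?_, ?_, ?_, ?_, ?_, ?_⟩, ⟨?_, ?_, ?_, ?_, ?_, ?_⟩, ⟨?_, ?_, ?_, ?_, ?_⟩,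
    ⟨?_, ?_, ?_, ?_⟩, ⟨?_, ?_, ?_⟩, ⟨?_, ?_⟩, ?_⟩ <;> grind

theorem dih_fixed_aux
    (k : Type*) [Field k] (p : ℕ) [CharP k p] (hp2 : p ≠ 2)
    (i : k) (hi : i ^ 2 = -1)
    (K : Type*) [Field K] [Algebra k K] [Algebra (MvPolynomial (Fin 3) k) K]
    [IsScalarTower k (MvPolynomial (Fin 3) k) K] [IsFractionRing (MvPolynomial (Fin 3) k) K]
    (a₁ a₂ a₃ : K)
    (ha₁ : a₁ = algebraMap (MvPolynomial (Fin 3) k) K (X 0))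
    (ha₂ : a₂ = algebraMap (MvPolynomial (Fin 3) k) K (X 1))
    (ha₃ : a₃ = algebraMap (MvPolynomial (Fin 3) k) K (X 2))
    (τ₁ τ₂ : K ≃ₐ[k] K)
    (hτ₁₁ : τ₁ a₁ = algebraMap k K i * a₁)
    (hτ₁₂ : τ₁ a₂ = -a₂)
    (hτ₁₃ : τ₁ a₃ = -(algebraMap k K i) * a₃)
    (hτ₂₁ : τ₂ a₁ = a₃) (hτ₂₂ : τ₂ a₂ = a₂) (hτ₂₃ : τ₂ a₃ = a₁) :
    IntermediateField.fixedField (Subgroup.closure {τ₁, τ₂}) =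
      IntermediateField.adjoin k
        {a₁ ^ 4 + a₃ ^ 4, (a₁ ^ 2 + a₃ ^ 2) * a₂, 2 * a₁ * a₃} := by
  have h2k : (2 : k) ≠ 0 := by
    apply Ring.two_ne_zero
    rwa [ringChar.eq k p]
  set I : K := algebraMap k K i with hIdef
  have h2 : (2 : K) ≠ 0 := by
    have := (map_ne_zero (algebraMap k K)).2 h2k
    rwa [map_ofNat] at this
  have hI : I ^ 2 = -1 := by rw [hIdef, ← map_pow, hi]; simp
  have hlin : ∀ c : k, a₁ ≠ algebraMap k K c * a₃ := by
    intro c h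
    rw [ha₁, ha₃, IsScalarTower.algebraMap_apply k (MvPolynomial (Fin 3) k) K, ← map_mul] at h
    have h' := IsFractionRing.injective (MvPolynomial (Fin 3) k) K h
    have := congrArg (MvPolynomial.eval ![1, 0, 0]) h'
    simp at this
  have ha0 : a₁ ≠ 0 := by simpa using hlin 0
  have hb0 : a₃ ≠ 0 := by
    intro h; apply ha0; apply τ₂.injective; rw [hτ₂₁, h, map_zero]
  have d1 : a₁ ≠ a₃ := by simpa using hlin 1
  have d2 : a₁ ≠ -a₃ := by simpa using hlin (-1)
  have d3 : a₁ ≠ I * a₃ := hlin i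
  have d4 : a₁ ≠ -(I * a₃) := by simpa [hIdef] using hlin (-i)
  have hinj := dih_distinct I a₁ a₃ h2 hI ha0 hb0 d1 d2 d3 d4
  have hsum : a₁ ^ 2 + a₃ ^ 2 ≠ 0 := by
    intro h
    have : (a₁ - I * a₃) * (a₁ - -(I * a₃)) = 0 := by linear_combination h - a₃ ^ 2 * hI
    rcases mul_eq_zero.1 this with h | h
    · exact d3 (sub_eq_zero.1 h)
    · exact d4 (sub_eq_zero.1 h)
  set S : Set K := {a₁ ^ 4 + a₃ ^ 4, (a₁ ^ 2 + a₃ ^ 2) * a₂, 2 * a₁ * a₃} with hS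
  set F := IntermediateField.adjoin k S with hF
  have hFle : F ≤ IntermediateField.fixedField (Subgroup.closure {τ₁, τ₂}) := by
    rw [IntermediateField.le_iff_le, Subgroup.closure_le]
    have hI4 : I ^ 4 = 1 := by linear_combination (I ^ 2 - 1) * hI
    have key : ∀ τ : K ≃ₐ[k] K, (∀ s ∈ S, τ s = s) → τ ∈ F.fixingSubgroup := by
      intro τ h
      rw [← Subgroup.zpowers_le, ← IntermediateField.le_iff_le, hF, IntermediateField.adjoin_le_iff]
      intro s hs
      rw [SetLike.mem_coe, IntermediateField.mem_fixedField_iff]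
      intro g hg
      have : Subgroup.zpowers τ ≤ MulAction.stabilizer (K ≃ₐ[k] K) s := by
        rw [Subgroup.zpowers_le]; exact h s hs
      exact this hg
    rintro τ (rfl | rfl) <;> apply key <;> rintro s (rfl | rfl | rfl)
    · simp only [map_add, map_pow, hτ₁₁, hτ₁₃]
      linear_combination (a₁ ^ 4 + a₃ ^ 4) * hI4
    · simp only [map_add, map_mul, map_pow, hτ₁₁, hτ₁₂, hτ₁₃]
      linear_combination -a₂ * (a₁ ^ 2 + a₃ ^ 2) * hI
    · simp only [map_mul, map_ofNat, hτ₁₁, hτ₁₃]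
      linear_combination -2 * a₁ * a₃ * hI
    · simp only [map_add, map_pow, hτ₂₁, hτ₂₃]; ring
    · simp only [map_add, map_mul, map_pow, hτ₂₁, hτ₂₂, hτ₂₃]; ring
    · simp only [map_mul, map_ofNat, hτ₂₁, hτ₂₃]; ring
  refine le_antisymm ?_ hFle
  intro x hx
  have s1 : a₁ ^ 4 + a₃ ^ 4 ∈ F := IntermediateField.subset_adjoin k S (by simp [hS])
  have s2 : (a₁ ^ 2 + a₃ ^ 2) * a₂ ∈ F := IntermediateField.subset_adjoin k S (by simp [hS])
  have s3 : 2 * a₁ * a₃ ∈ F := IntermediateField.subset_adjoin k S (by simp [hS])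
  have s3' : a₁ * a₃ ∈ F := by
    have : a₁ * a₃ = (2 * a₁ * a₃) / 2 := by field_simp
    rw [this]
    exact div_mem s3 (ofNat_mem F 2)
  obtain ⟨Q, hQm, hQd, hQ⟩ : ∃ Q : Polynomial F, Q.Monic ∧ Q.natDegree = 8 ∧
      Polynomial.aeval a₁ Q = 0 := by
    refine ⟨Polynomial.X ^ 8 - Polynomial.C ⟨_, s1⟩ * Polynomial.X ^ 4
      + Polynomial.C ⟨_, pow_mem s3' 4⟩, ?_, ?_, ?_⟩
    · monicity!
    · compute_degree!
    · simp only [map_add, map_sub, map_mul, map_pow, Polynomial.aeval_X, Polynomial.aeval_C,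
        IntermediateField.algebraMap_apply]
      ring
  have hint : IsIntegral F a₁ := ⟨Q, hQm, hQ⟩
  have htop : ∀ y : K, y ∈ IntermediateField.adjoin F {a₁} := by
    have m1 : a₁ ∈ IntermediateField.adjoin F {a₁} := IntermediateField.mem_adjoin_simple_self F a₁
    have mF : ∀ z ∈ F, z ∈ IntermediateField.adjoin F {a₁} := fun z hz =>
      (IntermediateField.adjoin F {a₁}).algebraMap_mem ⟨z, hz⟩
    have m3 : a₃ ∈ IntermediateField.adjoin F {a₁} := by
      have : a₃ = (a₁ * a₃) / a₁ := by field_simp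
      rw [this]
      exact div_mem (mF _ s3') m1
    have m2 : a₂ ∈ IntermediateField.adjoin F {a₁} := by
      have : a₂ = ((a₁ ^ 2 + a₃ ^ 2) * a₂) / (a₁ ^ 2 + a₃ ^ 2) := by field_simp
      rw [this]
      exact div_mem (mF _ s2) (add_mem (pow_mem m1 2) (pow_mem m3 2))
    have mp : ∀ q : MvPolynomial (Fin 3) k,
        algebraMap (MvPolynomial (Fin 3) k) K q ∈ IntermediateField.adjoin F {a₁} := by
      intro q
      induction q using MvPolynomial.induction_on with
      | C c =>
        rw [← MvPolynomial.algebraMap_eq, ← IsScalarTower.algebraMap_apply]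
        exact mF _ (F.algebraMap_mem c)
      | add p q hp hq => rw [map_add]; exact add_mem hp hq
      | mul_X p n hp =>
        rw [map_mul]
        refine mul_mem hp ?_
        fin_cases n
        · exact ha₁ ▸ m1
        · exact ha₂ ▸ m2
        · exact ha₃ ▸ m3
    intro y
    obtain ⟨u, v, -, rfl⟩ := IsFractionRing.div_surjective (A := MvPolynomial (Fin 3) k) y
    exact div_mem (mp u) (mp v)
  obtain ⟨P, hP⟩ : ∃ P : Polynomial F, Polynomial.aeval a₁ P = x := by
    have h := htop x
    rw [← IntermediateField.mem_toSubalgebra,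
      IntermediateField.adjoin_simple_toSubalgebra_of_isAlgebraic hint.isAlgebraic,
      Algebra.adjoin_singleton_eq_range_aeval] at h
    exact h
  set R := P %ₘ Q with hR
  have hRx : Polynomial.aeval a₁ R = x := by
    rw [hR, Polynomial.aeval_modByMonic_eq_self_of_root hQ, hP]
  have hRd : R.natDegree < 8 := by
    rw [← hQd]
    refine Polynomial.natDegree_modByMonic_lt P hQm ?_
    rintro rfl
    simp at hQd
  have hG : ∀ g ∈ Subgroup.closure {τ₁, τ₂}, ∀ y : K, Polynomial.aeval y R = x →
      Polynomial.aeval (g y) R = x := by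
    intro g hg y hy
    have hgx : g x = x := (IntermediateField.mem_fixedField_iff _ _).1 hx g hg
    have hgF : ∀ c : F, g (c : K) = c := fun c =>
      (IntermediateField.mem_fixedField_iff _ _).1 (hFle c.2) g hg
    conv_rhs => rw [← hgx, ← hy]
    rw [Polynomial.aeval_eq_sum_range, Polynomial.aeval_eq_sum_range, map_sum]
    refine Finset.sum_congr rfl fun n _ => ?_
    rw [Algebra.smul_def, Algebra.smul_def, map_mul, map_pow]
    congr 1
    exact (hgF _).symm
  have g1 := hG τ₁ (Subgroup.subset_closure (by simp))
  have g2 := hG τ₂ (Subgroup.subset_closure (by simp))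
  have t1I : τ₁ I = I := τ₁.commutes i
  have t2I : τ₂ I = I := τ₂.commutes i
  have r1 := hRx
  have r2 := g1 _ r1
  rw [hτ₁₁] at r2
  have r3 := g1 _ r2
  rw [map_mul, t1I, hτ₁₁, show I * (I * a₁) = -a₁ by linear_combination a₁ * hI] at r3
  have r4 := g1 _ r3
  rw [map_neg, hτ₁₁] at r4
  have q1 := g2 _ r1
  have q2 := g2 _ r2
  have q3 := g2 _ r3
  have q4 := g2 _ r4
  simp only [map_neg, map_mul, t2I, hτ₂₁] at q1 q2 q3 q4
  have hzero : R.map (algebraMap F K) - Polynomial.C x = 0 := by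
    refine Polynomial.eq_zero_of_natDegree_lt_card_of_eval_eq_zero _ hinj ?_ ?_
    · intro j
      rw [Polynomial.eval_sub, Polynomial.eval_C, Polynomial.eval_map_algebraMap, sub_eq_zero]
      fin_cases j
      exacts [r1, r2, r3, r4, q1, q2, q3, q4]
    · rw [Polynomial.natDegree_sub_C, Fintype.card_fin]
      exact lt_of_le_of_lt Polynomial.natDegree_map_le hRd
  have h0 := congrArg (fun f => Polynomial.coeff f 0) hzero
  simp only [Polynomial.coeff_sub, Polynomial.coeff_map, Polynomial.coeff_C_zero,
    Polynomial.coeff_zero] at h0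
  rw [← sub_eq_zero.1 h0]
  exact (R.coeff 0).2

/-- Let `k` be an algebraically closed field of characteristic
different from `2`, and let `i ∈ k` satisfy `i² = −1`.  Let `K = k(a₁, a₂, a₃)` be the
field of rational functions in three independent variables, and let `G` be the group of
`k`-algebra automorphisms of `K` generated by
`τ₁ : (a₁, a₂, a₃) ↦ (i·a₁, −a₂, −i·a₃)` and `τ₂ : (a₁, a₂, a₃) ↦ (a₃, a₂, a₁)`
(a dihedral group of order `8`).  Then the fixed field `K^G` equals `k(s₁, s₂, s₃)`,
the subfield generated over `k` by `s₁ = a₁⁴ + a₃⁴`, `s₂ = (a₁² + a₃²)·a₂` and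
`s₃ = 2a₁a₃`. -/
theorem fixedField_dihedral_genus_three_s_invariants
    (k : Type*) [Field k] [IsAlgClosed k] (p : ℕ) [CharP k p] (hp2 : p ≠ 2)
    (i : k) (hi : i ^ 2 = -1)
    (a₁ a₂ a₃ : FractionRing (MvPolynomial (Fin 3) k))
    (ha₁ : a₁ = algebraMap (MvPolynomial (Fin 3) k)
      (FractionRing (MvPolynomial (Fin 3) k)) (X 0))
    (ha₂ : a₂ = algebraMap (MvPolynomial (Fin 3) k)
      (FractionRing (MvPolynomial (Fin 3) k)) (X 1))
    (ha₃ : a₃ = algebraMap (MvPolynomial (Fin 3) k)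
      (FractionRing (MvPolynomial (Fin 3) k)) (X 2))
    (τ₁ τ₂ : FractionRing (MvPolynomial (Fin 3) k) ≃ₐ[k]
      FractionRing (MvPolynomial (Fin 3) k))
    (hτ₁₁ : τ₁ a₁ = algebraMap k (FractionRing (MvPolynomial (Fin 3) k)) i * a₁)
    (hτ₁₂ : τ₁ a₂ = -a₂)
    (hτ₁₃ : τ₁ a₃ = -(algebraMap k (FractionRing (MvPolynomial (Fin 3) k)) i) * a₃)
    (hτ₂₁ : τ₂ a₁ = a₃) (hτ₂₂ : τ₂ a₂ = a₂) (hτ₂₃ : τ₂ a₃ = a₁) :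
    IntermediateField.fixedField (Subgroup.closure {τ₁, τ₂}) =
      IntermediateField.adjoin k
        {a₁ ^ 4 + a₃ ^ 4, (a₁ ^ 2 + a₃ ^ 2) * a₂, 2 * a₁ * a₃} := by
  exact dih_fixed_aux k p hp2 i hi _ a₁ a₂ a₃ ha₁ ha₂ ha₃ τ₁ τ₂ hτ₁₁ hτ₁₂ hτ₁₃ hτ₂₁ hτ₂₂ hτ₂₃
end

section
/- Let k be a field of characteristic 0, let δ ≥ 1, and let λ₁, …, λ_δ ∈ k. Let F(X,Z) = ∏_{i=1}^{δ} (X^{12} − λ_i X^{10}Z² − 33X⁸Z⁴ + 2λ_i X⁶Z⁶ − 33X⁴Z⁸ − λ_i X²Z^{10} + Z^{12}), a binary form of degree d = 12δ (the binary form of the generic superelliptic curve y^n = f(x) with reduced automorphism group A₄). Set J₄ := (F,F)^{d−2} and I₄ := (J₄, J₄)⁴. Then I₄ = 0. -/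
open MvPolynomial Finset

/-- The `r`-th transvection (transvectant) of two binary forms `f, g ∈ k[X,Z]` of
degrees `n` and `m` respectively:
`(f,g)^r = ((m−r)!(n−r)!/(n!·m!)) · Σ_{j=0}^{r} (−1)^j C(r,j) ·
  (∂^r f/∂X^{r−j}∂Z^{j}) · (∂^r g/∂X^{j}∂Z^{r−j})`.
Binary forms are represented as polynomials in `MvPolynomial (Fin 2) k`, with `X` the
variable of index `0` and `Z` the variable of index `1`. -/
noncomputable def transvect {k : Type*} [Field k] (n m r : ℕ)
    (f g : MvPolynomial (Fin 2) k) : MvPolynomial (Fin 2) k :=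
  let DX : MvPolynomial (Fin 2) k → MvPolynomial (Fin 2) k := fun h => pderiv (0 : Fin 2) h
  let DZ : MvPolynomial (Fin 2) k → MvPolynomial (Fin 2) k := fun h => pderiv (1 : Fin 2) h
  C ((((m - r).factorial * (n - r).factorial : ℕ) : k) /
      ((n.factorial * m.factorial : ℕ) : k)) *
    ∑ j ∈ range (r + 1),
      C ((-1 : k) ^ j * (r.choose j : k)) * (DX^[r - j] (DZ^[j] f)) * (DZ^[r - j] (DX^[j] g))

section Helpers
open TensorProduct

noncomputable def pdL (k : Type*) [Field k] (i : Fin 2) : Module.End k (MvPolynomial (Fin 2) k) :=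
  (pderiv (R := k) i).toLinearMap

noncomputable def omA (k : Type*) [Field k] (i j : Fin 2) :
    Module.End k (MvPolynomial (Fin 2) k ⊗[k] MvPolynomial (Fin 2) k) :=
  TensorProduct.map (pdL k i) (pdL k j)

noncomputable def om (k : Type*) [Field k] :
    Module.End k (MvPolynomial (Fin 2) k ⊗[k] MvPolynomial (Fin 2) k) :=
  (-1 : k) • omA k 1 0 + omA k 0 1

lemma pdL_comm (k : Type*) [Field k] (i j : Fin 2) : Commute (pdL k i) (pdL k j) := by
  refine LinearMap.ext fun f => ?_
  change pderiv i (pderiv j f) = pderiv j (pderiv i f)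
  have h : ⁅pderiv (R := k) i, pderiv (R := k) j⁆ = 0 := by
    apply MvPolynomial.derivation_ext
    intro a
    rw [Derivation.commutator_apply]
    simp only [pderiv_X, Pi.single_apply]
    split_ifs <;> simp
  have h2 := congrArg (fun D => D f) h
  simp only [Derivation.commutator_apply] at h2
  exact sub_eq_zero.mp h2

lemma omA_comm (k : Type*) [Field k] : Commute (omA k 0 1) (omA k 1 0) := by
  unfold Commute SemiconjBy omA
  rw [← TensorProduct.map_mul, ← TensorProduct.map_mul, (pdL_comm k 0 1).eq]

/-- The un-normalized transvectant. -/
noncomputable def tv {k : Type*} [Field k] (r : ℕ) (f g : MvPolynomial (Fin 2) k) :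
    MvPolynomial (Fin 2) k :=
  LinearMap.mul' k (MvPolynomial (Fin 2) k) ((om k ^ r) (f ⊗ₜ g))

lemma tv_eq {k : Type*} [Field k] (r : ℕ) (f g : MvPolynomial (Fin 2) k) :
    tv r f g = ∑ j ∈ range (r + 1), C ((-1 : k) ^ j * (r.choose j : k)) *
      ((fun h => pderiv (0 : Fin 2) h)^[r - j] ((fun h => pderiv (1 : Fin 2) h)^[j] f)) *
      ((fun h => pderiv (1 : Fin 2) h)^[r - j] ((fun h => pderiv (0 : Fin 2) h)^[j] g)) := by
  have hc : Commute ((-1 : k) • omA k 1 0) (omA k 0 1) := (omA_comm k).symm.smul_left _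
  unfold tv om
  rw [hc.add_pow, LinearMap.sum_apply, map_sum]
  refine Finset.sum_congr rfl fun j _ => ?_
  have e : ((-1 : k) • omA k 1 0) ^ j * omA k 0 1 ^ (r - j) * (r.choose j : Module.End k _)
      = ((-1 : k) ^ j * (r.choose j : k)) • (omA k 0 1 ^ (r - j) * omA k 1 0 ^ j) := by
    rw [(hc.pow_pow j (r - j)).eq, smul_pow, mul_smul, mul_smul_comm, ← nsmul_eq_mul',
      ← Nat.cast_smul_eq_nsmul k, smul_comm]
  rw [e]
  unfold omA
  rw [TensorProduct.map_pow, TensorProduct.map_pow, LinearMap.smul_apply, Module.End.mul_apply,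
    TensorProduct.map_tmul, TensorProduct.map_tmul, map_smul, LinearMap.mul'_apply,
    MvPolynomial.smul_eq_C_mul, mul_assoc]
  simp only [Module.End.pow_apply]
  rfl

lemma transvect_eq {k : Type*} [Field k] (n m r : ℕ) (f g : MvPolynomial (Fin 2) k) :
    transvect n m r f g = C ((((m - r).factorial * (n - r).factorial : ℕ) : k) /
      ((n.factorial * m.factorial : ℕ) : k)) * tv r f g := by
  rw [tv_eq]; rfl

/-- Linear substitution `X ↦ aX + bZ`, `Z ↦ cX + dZ`. -/
noncomputable def sub {k : Type*} [Field k] (a b c d : k) :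
    MvPolynomial (Fin 2) k →ₐ[k] MvPolynomial (Fin 2) k :=
  aeval ![C a * X 0 + C b * X 1, C c * X 0 + C d * X 1]

lemma sub_X0 {k : Type*} [Field k] (a b c d : k) :
    sub a b c d (X 0) = C a * X 0 + C b * X 1 := by simp [sub]
lemma sub_X1 {k : Type*} [Field k] (a b c d : k) :
    sub a b c d (X 1) = C c * X 0 + C d * X 1 := by simp [sub]
lemma sub_C {k : Type*} [Field k] (a b c d e : k) :
    sub a b c d (C e) = C e := by simp [sub]

lemma pd0_sub {k : Type*} [Field k] (a b c d : k) :
    pdL k 0 * (sub a b c d).toLinearMap =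
      (sub a b c d).toLinearMap * (a • pdL k 0 + c • pdL k 1) := by
  refine LinearMap.ext fun f => ?_
  change pderiv 0 (sub a b c d f) = sub a b c d (a • pderiv 0 f + c • pderiv 1 f)
  induction f using MvPolynomial.induction_on with
  | C e => simp [sub_C]
  | add p q hp hq => simp only [map_add, hp, hq, smul_add]; abel
  | mul_X p i hp =>
    rw [map_mul, Derivation.leibniz, hp]
    fin_cases i <;>
    · simp [sub_X0, sub_X1, Derivation.leibniz, MvPolynomial.smul_eq_C_mul, sub_C,
        pderiv_X_of_ne]
      ring

lemma pd1_sub {k : Type*} [Field k] (a b c d : k) :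
    pdL k 1 * (sub a b c d).toLinearMap =
      (sub a b c d).toLinearMap * (b • pdL k 0 + d • pdL k 1) := by
  refine LinearMap.ext fun f => ?_
  change pderiv 1 (sub a b c d f) = sub a b c d (b • pderiv 0 f + d • pderiv 1 f)
  induction f using MvPolynomial.induction_on with
  | C e => simp [sub_C]
  | add p q hp hq => simp only [map_add, hp, hq, smul_add]; abel
  | mul_X p i hp =>
    rw [map_mul, Derivation.leibniz, hp]
    fin_cases i <;>
    · simp [sub_X0, sub_X1, Derivation.leibniz, MvPolynomial.smul_eq_C_mul, sub_C,
        pderiv_X_of_ne]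
      ring

lemma om_sub {k : Type*} [Field k] (a b c d : k) :
    om k * TensorProduct.map (sub a b c d).toLinearMap (sub a b c d).toLinearMap =
      TensorProduct.map (sub a b c d).toLinearMap (sub a b c d).toLinearMap *
        ((a * d - b * c) • om k) := by
  unfold om omA
  rw [add_mul, smul_mul_assoc, ← TensorProduct.map_mul, ← TensorProduct.map_mul, pd0_sub, pd1_sub,
    TensorProduct.map_mul, TensorProduct.map_mul, ← mul_smul_comm, ← mul_add]
  congr 1
  simp only [TensorProduct.map_add_left, TensorProduct.map_add_right, TensorProduct.map_smul_left,
    TensorProduct.map_smul_right]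
  module

lemma om_pow_sub {k : Type*} [Field k] (a b c d : k) (r : ℕ) :
    om k ^ r * TensorProduct.map (sub a b c d).toLinearMap (sub a b c d).toLinearMap =
      TensorProduct.map (sub a b c d).toLinearMap (sub a b c d).toLinearMap *
        ((a * d - b * c) • om k) ^ r := by
  have h : SemiconjBy (TensorProduct.map (sub a b c d).toLinearMap (sub a b c d).toLinearMap)
     ((a * d - b * c) • om k) (om k) := (om_sub a b c d).symm
  exact (h.pow_right r).eq.symm

lemma tv_sub {k : Type*} [Field k] (a b c d : k) (r : ℕ) (f g : MvPolynomial (Fin 2) k) :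
    tv r (sub a b c d f) (sub a b c d g) = C ((a * d - b * c) ^ r) * sub a b c d (tv r f g) := by
  unfold tv
  have h := congrArg (fun L => L (f ⊗ₜ[k] g)) (om_pow_sub a b c d r)
  simp only [Module.End.mul_apply, TensorProduct.map_tmul, AlgHom.toLinearMap_apply] at h
  rw [h, smul_pow, LinearMap.smul_apply, map_smul, map_smul, MvPolynomial.smul_eq_C_mul]
  congr 1
  generalize (om k ^ r) (f ⊗ₜ[k] g) = t
  induction t using TensorProduct.induction_on with
  | zero => simp
  | tmul x y => simp
  | add x y hx hy => simp only [map_add, hx, hy]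

lemma tv_smul {k : Type*} [Field k] (e : k) (r : ℕ) (f g : MvPolynomial (Fin 2) k) :
    tv r (C e * f) (C e * g) = C (e ^ 2) * tv r f g := by
  unfold tv
  rw [← MvPolynomial.smul_eq_C_mul, ← MvPolynomial.smul_eq_C_mul, ← MvPolynomial.smul_eq_C_mul,
    TensorProduct.smul_tmul_smul, map_smul, map_smul, sq]

lemma iter_hom {k : Type*} [Field k] (i : Fin 2) (n j : ℕ) (f : MvPolynomial (Fin 2) k)
    (hf : f.IsHomogeneous n) : ((fun h => pderiv i h)^[j] f).IsHomogeneous (n - j) := by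
  induction j with
  | zero => simpa using hf
  | succ j ih =>
    rw [Function.iterate_succ_apply']
    exact ih.pderiv

lemma tv_hom {k : Type*} [Field k] (n r : ℕ) (f g : MvPolynomial (Fin 2) k)
    (hf : f.IsHomogeneous n) (hg : g.IsHomogeneous n) :
    (tv r f g).IsHomogeneous (2 * (n - r)) := by
  rw [tv_eq]
  refine IsHomogeneous.sum _ _ _ fun j hj => ?_
  have hj' : j ≤ r := by simpa [Nat.lt_succ_iff] using hj
  have h1 := iter_hom 0 _ (r - j) _ (iter_hom 1 n j f hf)
  have h2 := iter_hom 1 _ (r - j) _ (iter_hom 0 n j g hg)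
  have := ((isHomogeneous_C (Fin 2) ((-1 : k) ^ j * (r.choose j : k))).mul h1).mul h2
  convert this using 1
  omega

lemma quartic {k : Type*} [Field k] (f : MvPolynomial (Fin 2) k) (hf : f.IsHomogeneous 4) :
    ∃ a b c d e : k, f = C a * X 0 ^ 4 + C b * X 0 ^ 3 * X 1 + C c * X 0 ^ 2 * X 1 ^ 2
      + C d * X 0 * X 1 ^ 3 + C e * X 1 ^ 4 := by
  rw [f.as_sum]
  refine Finset.sum_induction _ (fun f : MvPolynomial (Fin 2) k => ∃ a b c d e : k,
      f = C a * X 0 ^ 4 + C b * X 0 ^ 3 * X 1 + C c * X 0 ^ 2 * X 1 ^ 2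
      + C d * X 0 * X 1 ^ 3 + C e * X 1 ^ 4) ?_ ?_ ?_
  · rintro _ _ ⟨a, b, c, d, e, rfl⟩ ⟨a', b', c', d', e', rfl⟩
    refine ⟨a + a', b + b', c + c', d + d', e + e', ?_⟩
    simp only [map_add]
    ring
  · exact ⟨0, 0, 0, 0, 0, by simp⟩
  · intro v hv
    have h4 := hf (mem_support_iff.mp hv)
    have h5 : v 0 + v 1 = 4 := by
      rw [← h4, Finsupp.weight_apply, Finsupp.sum_fintype _ _ (by simp)]
      simp
    have hm : monomial v (coeff v f) = C (coeff v f) * (X 0 ^ v 0 * X 1 ^ v 1) := by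
      rw [monomial_eq, Finsupp.prod_fintype _ _ (by simp)]
      simp
    rw [hm]
    generalize coeff v f = a
    have h6 : v 0 ≤ 4 := by omega
    have h7 : v 1 = 4 - v 0 := by omega
    rw [h7]
    generalize v 0 = n at h6
    interval_cases n
    · exact ⟨0, 0, 0, 0, a, by simp⟩
    · exact ⟨0, 0, 0, a, 0, by simp; ring⟩
    · exact ⟨0, 0, a, 0, 0, by simp; ring⟩
    · exact ⟨0, a, 0, 0, 0, by simp; ring⟩
    · exact ⟨a, 0, 0, 0, 0, by simp⟩

lemma quartic_zero {k : Type*} [Field k] [CharZero k] (I : k) (hI : I ^ 2 = -1)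
    (f : MvPolynomial (Fin 2) k) (hf : f.IsHomogeneous 4)
    (h1 : sub 1 0 0 (-1) f = f) (h2 : sub 0 1 1 0 f = f)
    (h3 : sub 1 I 1 (-I) f = C (-4) * f) : f = 0 := by
  obtain ⟨a, b, c, d, e, rfl⟩ := quartic f hf
  simp only [map_add, map_mul, map_pow, sub_X0, sub_X1, sub_C] at h1 h2 h3
  have A := congrArg (eval ![(1 : k), 1]) h1
  have B := congrArg (eval ![(2 : k), 1]) h1
  have D := congrArg (eval ![(1 : k), 0]) h2
  have E := congrArg (eval ![(1 : k), 0]) h3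
  have G := congrArg (eval ![(1 : k), 1]) h3
  simp at A B D E G
  have hb : b = 0 := by linear_combination (-1 / 12) * B + (1 / 6 : k) * A * (1 / 2 * 2)
  have hd : d = 0 := by linear_combination (-1 / 2 : k) * A - hb
  have he : e = a := D
  subst hb hd he
  have hc : c = 0 := by
    have I4 : I ^ 4 = 1 := by linear_combination (I ^ 2 - 1) * hI
    linear_combination (1 / 8 : k) * G + (c * (3 / 8) - e * (5 / 4)) * 0 + (c / 8 - 0) * 0 + (-(c / 8) - e / 4) * I4 + (c / 4 - 3 * e / 2) * hI
  subst hc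
  have he : e = 0 := by linear_combination (1 / 6 : k) * E
  subst he
  simp

noncomputable def fac {k : Type*} [Field k] (l : k) : MvPolynomial (Fin 2) k :=
  (X (0 : Fin 2) ^ 12
        - C l * X (0 : Fin 2) ^ 10 * X (1 : Fin 2) ^ 2
        - 33 * X (0 : Fin 2) ^ 8 * X (1 : Fin 2) ^ 4
        + 2 * C l * X (0 : Fin 2) ^ 6 * X (1 : Fin 2) ^ 6
        - 33 * X (0 : Fin 2) ^ 4 * X (1 : Fin 2) ^ 8
        - C l * X (0 : Fin 2) ^ 2 * X (1 : Fin 2) ^ 10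
        + X (1 : Fin 2) ^ 12)

lemma fac_hom {k : Type*} [Field k] (l : k) : (fac l).IsHomogeneous 12 := by
  have key : ∀ (c : k) (i j : ℕ), i + j = 12 →
      (C c * X (0 : Fin 2) ^ i * X (1 : Fin 2) ^ j : MvPolynomial (Fin 2) k).IsHomogeneous 12 := by
    intro c i j h
    have := ((isHomogeneous_C (Fin 2) c).mul (isHomogeneous_X_pow (R := k) (0 : Fin 2) i)).mul
      (isHomogeneous_X_pow (R := k) (1 : Fin 2) j)
    rwa [zero_add, h] at this
  have e : fac l = C 1 * X 0 ^ 12 * X 1 ^ 0 - C l * X 0 ^ 10 * X 1 ^ 2 - C 33 * X 0 ^ 8 * X 1 ^ 4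
      + C (2 * l) * X 0 ^ 6 * X 1 ^ 6 - C 33 * X 0 ^ 4 * X 1 ^ 8 - C l * X 0 ^ 2 * X 1 ^ 10
      + C 1 * X 0 ^ 0 * X 1 ^ 12 := by
    have h33 : (C 33 : MvPolynomial (Fin 2) k) = 33 := map_ofNat C 33
    have h2 : (C 2 : MvPolynomial (Fin 2) k) = 2 := map_ofNat C 2
    simp [fac, h33, h2]
  rw [e]
  exact ((((((key _ _ _ rfl).sub (key _ _ _ rfl)).sub (key _ _ _ rfl)).add (key _ _ _ rfl)).sub
    (key _ _ _ rfl)).sub (key _ _ _ rfl)).add (key _ _ _ rfl)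

lemma fac_sub1 {k : Type*} [Field k] (l : k) : sub 1 0 0 (-1) (fac l) = fac l := by
  simp only [fac, map_add, map_sub, map_mul, map_pow, sub_X0, sub_X1, sub_C, map_ofNat, map_one,
    map_zero, map_neg]
  ring

lemma fac_sub2 {k : Type*} [Field k] (l : k) : sub 0 1 1 0 (fac l) = fac l := by
  simp only [fac, map_add, map_sub, map_mul, map_pow, sub_X0, sub_X1, sub_C, map_ofNat, map_one,
    map_zero, map_neg]
  ring

lemma fac_sub3 {k : Type*} [Field k] (l I : k) (hI : I ^ 2 = -1) :
    sub 1 I 1 (-I) (fac l) = C (-64) * fac l := by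
  have h : (C I : MvPolynomial (Fin 2) k) ^ 2 = -1 := by rw [← map_pow, hI]; simp
  have h4 : (C I : MvPolynomial (Fin 2) k) ^ 4 = 1 := by
    linear_combination (C I ^ 2 - 1) * h
  have h6 : (C I : MvPolynomial (Fin 2) k) ^ 6 = -1 := by
    linear_combination C I ^ 2 * h4 + h
  have h8 : (C I : MvPolynomial (Fin 2) k) ^ 8 = 1 := by
    linear_combination (C I ^ 4 + 1) * h4
  have h10 : (C I : MvPolynomial (Fin 2) k) ^ 10 = -1 := by
    linear_combination C I ^ 2 * h8 + h
  have h12 : (C I : MvPolynomial (Fin 2) k) ^ 12 = 1 := by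
    linear_combination C I ^ 4 * h8 + h4
  simp only [fac, map_add, map_sub, map_mul, map_pow, sub_X0, sub_X1, sub_C, map_ofNat, map_one,
    map_zero, map_neg]
  ring_nf
  simp only [h, h4, h6, h8, h10, h12]
  ring

lemma tv_zero {k : Type*} [Field k] [CharZero k] (I : k) (hI : I ^ 2 = -1) (δ : ℕ) (hδ : 1 ≤ δ)
    (l : Fin δ → k) : tv (12 * δ - 2) (∏ i, fac (l i)) (∏ i, fac (l i)) = 0 := by
  set F := ∏ i, fac (l i) with hF
  have s1 : sub 1 0 0 (-1) F = F := by simp only [hF, map_prod, fac_sub1]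
  have s2 : sub 0 1 1 0 F = F := by simp only [hF, map_prod, fac_sub2]
  have s3 : sub 1 I 1 (-I) F = C ((-64) ^ δ) * F := by
    simp only [hF, map_prod, fac_sub3 _ I hI, Finset.prod_mul_distrib]
    simp
  have hh : F.IsHomogeneous (12 * δ) := by
    have := IsHomogeneous.prod Finset.univ (fun i => fac (l i)) (fun _ => 12)
      (fun i _ => fac_hom (l i))
    simpa [mul_comm] using this
  obtain ⟨e, rfl⟩ : ∃ e, δ = e + 1 := ⟨δ - 1, by omega⟩
  have hr : 12 * (e + 1) - 2 = 2 * (6 * e + 5) := by omega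
  have hm : ((-1 : k)) ^ (12 * (e + 1) - 2) = 1 := by rw [hr, pow_mul]; simp
  refine quartic_zero I hI _ ?_ ?_ ?_ ?_
  · have := tv_hom _ (12 * (e + 1) - 2) F F hh hh
    convert this using 1
    omega
  · have := tv_sub 1 0 0 (-1) (12 * (e + 1) - 2) F F
    rw [s1] at this
    simpa [hm] using this.symm
  · have := tv_sub 0 1 1 0 (12 * (e + 1) - 2) F F
    rw [s2] at this
    simpa [hm] using this.symm
  · have := tv_sub 1 I 1 (-I) (12 * (e + 1) - 2) F F
    rw [s3, tv_smul] at this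
    have h1 : (1 * -I - I * 1) ^ (12 * (e + 1) - 2) = (4096 : k) ^ e * (-1024) := by
      rw [hr, pow_mul, show (1 * -I - I * 1) ^ 2 = (-4 : k) by linear_combination 4 * hI,
        pow_add, pow_mul]
      norm_num
    have h2 : (((-64 : k)) ^ (e + 1)) ^ 2 = (4096 : k) ^ e * (-1024) * (-4) := by
      rw [← pow_mul, mul_comm, pow_mul, pow_succ]
      norm_num
      ring
    rw [h1, h2, map_mul, mul_assoc] at this
    refine (mul_left_cancel₀ ?_ this).symm
    rw [Ne, C_eq_zero]
    refine mul_ne_zero (pow_ne_zero _ (by norm_num)) (by norm_num)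

lemma map_tv {k K : Type*} [Field k] [Field K] (φ : k →+* K) (r : ℕ)
    (f g : MvPolynomial (Fin 2) k) : MvPolynomial.map φ (tv r f g) = tv r (MvPolynomial.map φ f) (MvPolynomial.map φ g) := by
  have it : ∀ (i : Fin 2) (j : ℕ) (f : MvPolynomial (Fin 2) k),
      MvPolynomial.map φ ((fun h => pderiv i h)^[j] f) = (fun h => pderiv i h)^[j] (MvPolynomial.map φ f) := by
    intro i j
    induction j with
    | zero => intro f; rfl
    | succ j ih => intro f; rw [Function.iterate_succ_apply, ih, Function.iterate_succ_apply,
        pderiv_map]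
  simp only [tv_eq, map_sum, map_mul, it, map_C, map_pow, map_neg, map_one, map_natCast]

end Helpers

/-- Let `k` be a field of characteristic `0`, `δ ≥ 1` and
`λ₁, …, λ_δ ∈ k`.  Let
`F(X,Z) = ∏_{i=1}^{δ} (X^12 − λ_i X^10 Z² − 33X⁸Z⁴ + 2λ_i X⁶Z⁶ − 33X⁴Z⁸ − λ_i X²Z^10 + Z^12)`,
a binary form of degree `d = 12δ` (the binary form of the generic superelliptic curve
with reduced automorphism group `A₄`).  Set `J₄ := (F,F)^{d−2}` (a covariant of order
`4`) and `I₄ := (J₄,J₄)⁴`.  Then `I₄ = 0`. -/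
theorem I4_eq_zero_of_A4_form
    (k : Type*) [Field k] [CharZero k] (δ : ℕ) (hδ : 1 ≤ δ) (l : Fin δ → k)
    (F : MvPolynomial (Fin 2) k)
    (hF : F = ∏ i : Fin δ,
      (X (0 : Fin 2) ^ 12
        - C (l i) * X (0 : Fin 2) ^ 10 * X (1 : Fin 2) ^ 2
        - 33 * X (0 : Fin 2) ^ 8 * X (1 : Fin 2) ^ 4
        + 2 * C (l i) * X (0 : Fin 2) ^ 6 * X (1 : Fin 2) ^ 6
        - 33 * X (0 : Fin 2) ^ 4 * X (1 : Fin 2) ^ 8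
        - C (l i) * X (0 : Fin 2) ^ 2 * X (1 : Fin 2) ^ 10
        + X (1 : Fin 2) ^ 12))
    (d : ℕ) (hd : d = 12 * δ)
    (J₄ : MvPolynomial (Fin 2) k) (hJ₄ : J₄ = transvect d d (d - 2) F F) :
    transvect 4 4 4 J₄ J₄ = 0 := by
  have hT : tv (12 * δ - 2) F F = 0 := by
    obtain ⟨I, hI⟩ := IsAlgClosed.exists_pow_nat_eq (-1 : AlgebraicClosure k) (n := 2) (by norm_num)
    have hinj := map_injective (σ := Fin 2) (algebraMap k (AlgebraicClosure k))
      (algebraMap k (AlgebraicClosure k)).injective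
    apply hinj
    have : MvPolynomial.map (algebraMap k (AlgebraicClosure k)) F
        = ∏ i, fac (algebraMap k (AlgebraicClosure k) (l i)) := by
      rw [hF, map_prod]
      refine Finset.prod_congr rfl fun i _ => ?_
      simp [fac]
    rw [map_tv, this, map_zero]
    have : CharZero (AlgebraicClosure k) := charZero_of_injective_algebraMap
      (algebraMap k (AlgebraicClosure k)).injective
    exact tv_zero I hI δ hδ _
  have hJ : J₄ = 0 := by rw [hJ₄, hd, transvect_eq, hT, mul_zero]
  rw [hJ, transvect_eq]
  have : tv 4 (0 : MvPolynomial (Fin 2) k) 0 = 0 := by unfold tv; simp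
  rw [this, mul_zero]
end
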